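/- Let S = {(0,1),(0,3),(0,5),(1,1),(1,2),(1,4),(2,2),(2,3),(2,4),(3,0),(3,1),(3,4),(3,5),(4,0),(4,2),(5,1),(5,5)} ⊆ ℕ×ℕ. The generalised toric code C_S over the field with 8 elements has minimum distance exactly 23: every nonzero codeword of C_S has Hamming weight at least 23, and some codeword of C_S has Hamming weight exactly 23. -/

import Mathlib

/-- `F8` is the finite field with 8 elements, `GF(2,3)`. -/
abbrev F8 : Type := GaloisField 2 3

/-- The evaluation vector of an exponent pair `(a, b)`: the function
`F8ˣ × F8ˣ → F8` sending `(x, y)` to `x ^ a * y ^ b`. -/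
noncomputable def evalVec (ab : ℕ × ℕ) : F8ˣ × F8ˣ → F8 :=
  fun xy => (xy.1 : F8) ^ ab.1 * (xy.2 : F8) ^ ab.2

/-- The Hamming weight of a vector `c : F8ˣ × F8ˣ → F8`: the number of
coordinates at which `c` is nonzero. -/
noncomputable def hammingWeight (c : F8ˣ × F8ˣ → F8) : ℕ :=
  Nat.card {p : F8ˣ × F8ˣ // c p ≠ 0}

/-- The set of exponent vectors. -/
def S : Set (ℕ × ℕ) := {(0,1),(0,3),(0,5),(1,1),(1,2),(1,4),(2,2),(2,3),(2,4),(3,0),(3,1),(3,4),(3,5),(4,0),(4,2),(5,1),(5,5)}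

set_option maxRecDepth 100000

noncomputable section

namespace Tor

def ite2 (b x y : Bool) : Bool := @Bool.rec (fun _ => Bool) y x b
def force (x : ℕ) (f : ℕ → Bool) : Bool :=
  @Nat.rec (fun _ => Bool) (f 0) (fun n _ => f (Nat.succ n)) x
def forceN (x : ℕ) (f : ℕ → ℕ) : ℕ :=
  @Nat.rec (fun _ => ℕ) (f 0) (fun n _ => f (Nat.succ n)) x
def pack (s : ℕ) (f : ℕ → ℕ) (n : ℕ) : ℕ :=
  @Nat.rec (fun _ => ℕ) 0 (fun k ih => Nat.add ih (Nat.shiftLeft (f k) (Nat.mul s k))) n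
/-- xor of those columns of `C` (128 bits each) selected by the low `n` bits of `x` -/
def lin (C : ℕ) (n : ℕ) (x : ℕ) : ℕ :=
  @Nat.rec (fun _ => ℕ) 0 (fun k ih => Nat.xor ih (Nat.mul (Nat.land (Nat.shiftRight x k) 1)
    (Nat.mod (Nat.shiftRight C (Nat.mul 128 k)) (Nat.pow 2 128)))) n
/-- number of nonzero (3-bit) nibbles among seven -/
def wt (x : ℕ) : ℕ :=
  Nat.mod (Nat.land (Nat.lor (Nat.lor x (Nat.shiftRight x 1)) (Nat.shiftRight x 2)) 17895697) 15
/-- weight of the row word `k*64+q` -/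
def W (C k q : ℕ) : ℕ :=
  wt (Nat.xor 17895697 (Nat.xor (lin C 15 (Nat.shiftLeft k 6)) (lin C 6 q)))
/-- the list used by `qs`, with a variable length and an abstract weight function -/
def qsN (w : ℕ → ℕ) (m n : ℕ) : List ℕ :=
  @Nat.rec (fun _ => List ℕ) []
    (fun q ih => @Bool.rec (fun _ => List ℕ) ih (q :: ih) (Nat.ble (w q) m)) n
def qs (C k m : ℕ) : List ℕ := qsN (W C k) m 64
def mn (a b : ℕ) : ℕ := @Bool.rec (fun _ => ℕ) b a (Nat.ble a b)
def mw (C k : ℕ) : ℕ :=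
  @Nat.rec (fun _ => ℕ) 7 (fun q ih => forceN (W C k q) fun w => mn ih w) 64
def fld (K o n : ℕ) : ℕ := Nat.land (Nat.shiftRight K o) n
def vec (C T o k : ℕ) : ℕ :=
  pack 8 (fun t => forceN (Nat.xor k (fld (lin T 6 t) o 511)) fun k => Nat.add (mw C k) 0) 64
def ones8 : ℕ := pack 8 (fun _ => 1) 64
def desc (body : ℕ → Bool) (n : ℕ) : ℕ → ℕ → Bool :=
  @Nat.rec (fun _ => ℕ → ℕ → Bool) (fun m t => ite2 (Nat.beq m 0) true (force t body))
   (fun n ih m t => ite2 (Nat.beq m 0) true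
      (ite2 (ih (Nat.shiftRight m (Nat.mul 8 (Nat.pow 2 n))) (Nat.add t (Nat.pow 2 n)))
        (ih (Nat.mod m (Nat.pow 2 (Nat.mul 8 (Nat.pow 2 n)))) t) false)) n
def allN (body : ℕ → Bool) (n : ℕ) : Bool :=
  @Nat.rec (fun _ => Bool) true (fun k ih => ite2 (body k) ih false) n
def allL (body : ℕ → Bool) (l : List ℕ) : Bool :=
  @List.rec ℕ (fun _ => Bool) true (fun a _ ih => ite2 (body a) ih false) l
def wtAt (C K o : ℕ) : ℕ :=
  forceN (fld K (Nat.add o 6) 511) fun k => forceN (fld K o 63) fun q => Nat.add (W C k q) 0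

def stage3 (C K s : ℕ) : Bool :=
  force (Nat.add s (wtAt C K 0)) fun s4 =>
  ite2 (Nat.ble 16 s4) true <|
  force (Nat.add s4 (wtAt C K 15)) fun s5 =>
  ite2 (Nat.ble 19 s5) true <|
  ite2 (Nat.ble 23 (Nat.add s5 (wtAt C K 60))) true
   (Nat.ble 1 (Nat.shiftRight K 75))
def stage2b (C Q3 K s : ℕ) : Bool :=
  force (fld K 51 511) fun k =>
  allL (fun r =>
    force (Nat.add s (W C k r)) fun s =>
    force (Nat.xor K (lin Q3 6 r)) fun K =>
    stage3 C K s) (qs C k (Nat.sub 12 s))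
def stage2 (C Q2 Q3 K s : ℕ) : Bool :=
  force (fld K 36 511) fun k =>
  allL (fun q =>
    force (Nat.add s (W C k q)) fun s =>
    force (Nat.xor K (lin Q2 6 q)) fun K =>
    stage2b C Q3 K s) (qs C k (Nat.sub 9 s))
def gt8 (v b : ℕ) : ℕ := Nat.add v (Nat.mul (Nat.sub 127 b) ones8)
def msk1 (v2 v3 v4 v5 v6 s : ℕ) : ℕ :=
   (Nat.xor (Nat.mul 128 ones8) (Nat.land (Nat.mul 128 ones8) (Nat.lor (gt8 v2 (Nat.sub 9 s))
    (Nat.lor (gt8 v3 (Nat.sub 12 s)) (Nat.lor (gt8 v4 (Nat.sub 15 s))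
     (Nat.lor (gt8 v5 (Nat.sub 18 s)) (gt8 v6 (Nat.sub 22 s))))))))
def msk2 (v2 v3 v4 v5 v6 s : ℕ) : ℕ :=
  msk1 v2 (Nat.add v2 v3) (Nat.add (Nat.add v2 v3) v4)
   (Nat.add (Nat.add (Nat.add v2 v3) v4) v5)
   (Nat.add (Nat.add (Nat.add (Nat.add v2 v3) v4) v5) v6) s
def stage1 (C T Q2 Q3 K s : ℕ) : Bool :=
  force (fld K 36 511) fun k2 =>
  force (fld K 51 511) fun k3 =>
  force (fld K 6 511) fun k4 =>
  force (fld K 21 511) fun k5 =>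
  force (fld K 66 511) fun k6 =>
  desc (fun t => force (Nat.xor K (lin T 6 t)) fun K => stage2 C Q2 Q3 K s) 6
   (msk2 (vec C T 36 k2) (vec C T 51 k3) (vec C T 6 k4) (vec C T 21 k5) (vec C T 66 k6) s) 0
def stage0 (C B0 B1 T Q2 Q3 : ℕ) (reps : List ℕ) : Bool :=
  allL (fun w => force (lin B0 15 w) fun K0 =>
    force (W C (Nat.shiftRight w 6) (Nat.land w 63)) fun s0 =>
    allN (fun k =>
     allL (fun q => force (Nat.add s0 (W C k q)) fun s =>
      force (Nat.xor K0 (lin B1 15 (Nat.add (Nat.mul k 64) q))) fun K =>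
      stage1 C T Q2 Q3 K s) (qs C k (Nat.sub 6 s0))) 512) reps


/-! ### Unfolding lemmas for the search primitives -/

theorem ite2_eq (b x y : Bool) : ite2 b x y = if b = true then x else y := by
  cases b <;> rfl
theorem force_eq (x : ℕ) (f : ℕ → Bool) : force x f = f x := by cases x <;> rfl
theorem forceN_eq (x : ℕ) (f : ℕ → ℕ) : forceN x f = f x := by cases x <;> rfl
theorem allN_true {body : ℕ → Bool} {n : ℕ} (h : allN body n = true) :
    ∀ k < n, body k = true := by
  induction n with
  | zero => intro k hk; omega
  | succ n ih =>
    have h' : ite2 (body n) (allN body n) false = true := h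
    rw [ite2_eq] at h'
    intro k hk
    by_cases hb : body n = true
    · rw [if_pos hb] at h'
      rcases Nat.lt_succ_iff_lt_or_eq.mp hk with hk | rfl
      · exact ih h' k hk
      · exact hb
    · rw [if_neg hb] at h'; cases h'
theorem allL_true {body : ℕ → Bool} {l : List ℕ} (h : allL body l = true) :
    ∀ k ∈ l, body k = true := by
  induction l with
  | nil => intro k hk; cases hk
  | cons a l ih =>
    have h' : ite2 (body a) (allL body l) false = true := h
    rw [ite2_eq] at h'
    intro k hk
    by_cases hb : body a = true
    · rw [if_pos hb] at h'
      rcases List.mem_cons.mp hk with rfl | hk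
      · exact hb
      · exact ih h' k hk
    · rw [if_neg hb] at h'; cases h'

theorem mem_qsN {w : ℕ → ℕ} {m : ℕ} (q n : ℕ) (hq : q < n) (h : w q ≤ m) : q ∈ qsN w m n := by
  induction n with
  | zero => omega
  | succ n ih =>
    have e : qsN w m (n+1) = @Bool.rec (fun _ => List ℕ) (qsN w m n) (n :: qsN w m n)
      (Nat.ble (w n) m) := rfl
    rw [e]
    rcases Nat.lt_succ_iff_lt_or_eq.mp hq with hq | rfl
    · have := ih hq
      cases Nat.ble (w n) m
      · exact this
      · exact List.mem_cons_of_mem _ this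
    · rw [Nat.ble_eq_true_of_le h]
      exact List.mem_cons_self
theorem mem_qs {C k m q : ℕ} (hq : q < 64) (h : W C k q ≤ m) : q ∈ qs C k m :=
  mem_qsN (w := W C k) q 64 hq h
theorem nadd_zero (x : ℕ) : Nat.add x 0 = x := rfl

theorem mn_eq (a b : ℕ) : mn a b = min a b := by
  unfold mn
  by_cases h : a ≤ b
  · rw [Nat.ble_eq_true_of_le h]; exact (min_eq_left h).symm
  · have : Nat.ble a b = false := by
      cases hb : Nat.ble a b
      · rfl
      · exact absurd (Nat.le_of_ble_eq_true hb) h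
    rw [this]; exact (min_eq_right (le_of_not_ge h)).symm

def mwN (C k n : ℕ) : ℕ :=
  @Nat.rec (fun _ => ℕ) 7 (fun q ih => forceN (W C k q) fun w => mn ih w) n
theorem mwN_succ (C k n : ℕ) : mwN C k (n+1) = min (mwN C k n) (W C k n) := by
  have : mwN C k (n+1) = forceN (W C k n) fun w => mn (mwN C k n) w := rfl
  rw [this, forceN_eq, mn_eq]
theorem mwN_le7 (C k n : ℕ) : mwN C k n ≤ 7 := by
  induction n with
  | zero => exact le_refl 7
  | succ n ih => rw [mwN_succ]; omega
theorem mwN_le (C k q n : ℕ) (hq : q < n) : mwN C k n ≤ W C k q := by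
  induction n with
  | zero => omega
  | succ n ih =>
    rw [mwN_succ]
    rcases Nat.lt_succ_iff_lt_or_eq.mp hq with hq | rfl
    · have := ih hq; omega
    · omega
theorem mw_le7 (C k : ℕ) : mw C k ≤ 7 := mwN_le7 C k 64
theorem mw_le (C k q : ℕ) (hq : q < 64) : mw C k ≤ W C k q := mwN_le C k q 64 hq

/-! ### Packed byte vectors -/

theorem pack_succ (s : ℕ) (f : ℕ → ℕ) (n : ℕ) :
    pack s f (n+1) = pack s f n + f n * 2^(s*n) := by
  have : pack s f (n+1) = pack s f n + (f n) <<< (s*n) := rfl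
  rw [this, Nat.shiftLeft_eq]
theorem pack_lt (f : ℕ → ℕ) (hf : ∀ k, f k < 256) (n : ℕ) : pack 8 f n < 2^(8*n) := by
  induction n with
  | zero => exact Nat.one_pos
  | succ n ih =>
    rw [pack_succ]
    have h1 := hf n
    have : 2^(8*(n+1)) = 256 * 2^(8*n) := by rw [Nat.mul_add, pow_add]; ring
    rw [this]
    nlinarith [Nat.mul_le_mul_right (2^(8*n)) (Nat.lt_succ_iff.mp h1 : f n ≤ 255)]
theorem pack_testBit (f : ℕ → ℕ) (hf : ∀ k, f k < 256) (n t b : ℕ) (ht : t < n) (hb : b < 8) :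
    (pack 8 f n).testBit (8*t+b) = (f t).testBit b := by
  induction n with
  | zero => omega
  | succ n ih =>
    rw [pack_succ, Nat.add_comm, Nat.mul_comm (f n),
      Nat.testBit_two_pow_mul_add _ (pack_lt f hf n)]
    rcases Nat.lt_succ_iff_lt_or_eq.mp ht with ht | rfl
    · rw [if_pos (by omega)]; exact ih ht
    · rw [if_neg (by omega)]; congr 1; omega
theorem pack_add (f g : ℕ → ℕ) (n : ℕ) :
    pack 8 f n + pack 8 g n = pack 8 (fun k => f k + g k) n := by
  induction n with
  | zero => rfl
  | succ n ih => rw [pack_succ, pack_succ, pack_succ, ← ih]; ring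
theorem pack_mul (c : ℕ) (f : ℕ → ℕ) (n : ℕ) :
    c * pack 8 f n = pack 8 (fun k => c * f k) n := by
  induction n with
  | zero => rfl
  | succ n ih => rw [pack_succ, pack_succ, ← ih]; ring

theorem gt8_pack (f : ℕ → ℕ) (b : ℕ) :
    gt8 (pack 8 f 64) b = pack 8 (fun k => f k + (127 - b)) 64 := by
  have : gt8 (pack 8 f 64) b = pack 8 f 64 + (127 - b) * pack 8 (fun _ => 1) 64 := rfl
  rw [this, pack_mul, pack_add]; simp
theorem gt8_bit (f : ℕ → ℕ) (hf : ∀ k, f k < 100) (b t : ℕ) (ht : t < 64) (h : f t ≤ b) :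
    (gt8 (pack 8 f 64) b).testBit (8*t+7) = false := by
  rw [gt8_pack, pack_testBit _ _ _ _ _ ht (by norm_num)]
  · apply Nat.testBit_lt_two_pow; have := hf t; norm_num; omega
  · intro k; have := hf k; omega
theorem msk1_bit (f2 f3 f4 f5 f6 : ℕ → ℕ) (h2 : ∀ k, f2 k < 100) (h3 : ∀ k, f3 k < 100)
    (h4 : ∀ k, f4 k < 100) (h5 : ∀ k, f5 k < 100) (h6 : ∀ k, f6 k < 100) (s t : ℕ) (ht : t < 64)
    (b2 : f2 t ≤ 9 - s) (b3 : f3 t ≤ 12 - s) (b4 : f4 t ≤ 15 - s) (b5 : f5 t ≤ 18 - s)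
    (b6 : f6 t ≤ 22 - s) :
    (msk1 (pack 8 f2 64) (pack 8 f3 64) (pack 8 f4 64) (pack 8 f5 64) (pack 8 f6 64) s).testBit
      (8*t+7) = true := by
  have e : msk1 (pack 8 f2 64) (pack 8 f3 64) (pack 8 f4 64) (pack 8 f5 64) (pack 8 f6 64) s =
    (128 * ones8) ^^^ ((128 * ones8) &&& (gt8 (pack 8 f2 64) (9 - s) |||
      (gt8 (pack 8 f3 64) (12 - s) ||| (gt8 (pack 8 f4 64) (15 - s) |||
      (gt8 (pack 8 f5 64) (18 - s) ||| gt8 (pack 8 f6 64) (22 - s)))))) := rfl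
  have o : (128 * ones8).testBit (8*t+7) = true := by
    unfold ones8
    rw [pack_mul, pack_testBit _ _ _ _ _ ht (by norm_num)]
    · decide
    · intro k; norm_num
  rw [e, Nat.testBit_xor, Nat.testBit_and, Nat.testBit_or, Nat.testBit_or, Nat.testBit_or,
    Nat.testBit_or, o, gt8_bit f2 h2 _ _ ht b2, gt8_bit f3 h3 _ _ ht b3, gt8_bit f4 h4 _ _ ht b4,
    gt8_bit f5 h5 _ _ ht b5, gt8_bit f6 h6 _ _ ht b6]
  rfl
theorem msk2_bit (f2 f3 f4 f5 f6 : ℕ → ℕ) (h2 : ∀ k, f2 k ≤ 7) (h3 : ∀ k, f3 k ≤ 7)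
    (h4 : ∀ k, f4 k ≤ 7) (h5 : ∀ k, f5 k ≤ 7) (h6 : ∀ k, f6 k ≤ 7) (s t : ℕ) (ht : t < 64)
    (b2 : s + f2 t ≤ 9) (b3 : s + f2 t + f3 t ≤ 12) (b4 : s + f2 t + f3 t + f4 t ≤ 15)
    (b5 : s + f2 t + f3 t + f4 t + f5 t ≤ 18)
    (b6 : s + f2 t + f3 t + f4 t + f5 t + f6 t ≤ 22) :
    (msk2 (pack 8 f2 64) (pack 8 f3 64) (pack 8 f4 64) (pack 8 f5 64) (pack 8 f6 64) s).testBit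
      (8*t+7) = true := by
  have e : msk2 (pack 8 f2 64) (pack 8 f3 64) (pack 8 f4 64) (pack 8 f5 64) (pack 8 f6 64) s =
    msk1 (pack 8 f2 64) (pack 8 f2 64 + pack 8 f3 64) (pack 8 f2 64 + pack 8 f3 64 + pack 8 f4 64)
     (pack 8 f2 64 + pack 8 f3 64 + pack 8 f4 64 + pack 8 f5 64)
     (pack 8 f2 64 + pack 8 f3 64 + pack 8 f4 64 + pack 8 f5 64 + pack 8 f6 64) s := rfl
  rw [e]
  simp only [pack_add]
  apply msk1_bit <;> first | assumption | (try intro k) <;>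
    (try have := h2 k) <;> (try have := h3 k) <;> (try have := h4 k) <;> (try have := h5 k) <;>
    (try have := h6 k) <;> omega

theorem desc_zero (body : ℕ → Bool) (m t : ℕ) :
    desc body 0 m t = ite2 (Nat.beq m 0) true (force t body) := rfl
theorem desc_succ (body : ℕ → Bool) (n m t : ℕ) : desc body (n+1) m t =
    ite2 (Nat.beq m 0) true (ite2 (desc body n (m >>> (8*2^n)) (t + 2^n))
      (desc body n (m % 2^(8*2^n)) t) false) := rfl
theorem desc_true {body : ℕ → Bool} (n : ℕ) : ∀ (m t0 : ℕ), desc body n m t0 = true →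
    ∀ t < 2^n, m.testBit (8*t+7) = true → body (t0 + t) = true := by
  have aux : ∀ m t : ℕ, m.testBit t = true → Nat.beq m 0 = false := by
    intro m t h
    cases m with
    | zero => simp at h
    | succ m => rfl
  induction n with
  | zero =>
    intro m t0 h t ht hb
    rw [desc_zero, aux _ _ hb, ite2_eq, force_eq] at h
    have : t = 0 := by simpa using ht
    subst this
    simpa using h
  | succ n ih =>
    intro m t0 h t ht hb
    rw [desc_succ, aux _ _ hb, ite2_eq, ite2_eq] at h
    simp only [Bool.false_eq_true, if_false] at h
    by_cases h1 : desc body n (m >>> (8*2^n)) (t0 + 2^n) = true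
    · rw [if_pos h1] at h
      by_cases hlt : t < 2^n
      · apply ih _ _ h t hlt
        rw [Nat.testBit_mod_two_pow, hb]
        simp; omega
      · have h2 := ih _ _ h1 (t - 2^n) (by rw [pow_succ] at ht; omega) (by
          rw [Nat.testBit_shiftRight]
          have : 8 * 2^n + (8 * (t - 2^n) + 7) = 8 * t + 7 := by omega
          rw [this]; exact hb)
        have : t0 + 2^n + (t - 2^n) = t0 + t := by omega
        rwa [this] at h2
    · rw [if_neg h1] at h; cases h


/-! ### Additive functions on bit words -/

/-- `F` is additive for bitwise exclusive or -/
def Xadd (F : ℕ → ℕ) : Prop := ∀ x y, F (x ^^^ y) = F x ^^^ F y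

theorem Xadd.zero {F : ℕ → ℕ} (h : Xadd F) : F 0 = 0 := by
  have := h 0 0
  simpa using this
theorem Xadd.comp {F G : ℕ → ℕ} (hF : Xadd F) (hG : Xadd G) : Xadd fun x => F (G x) := by
  intro x y; simp only [hG x y, hF _ _]
theorem Xadd.xor {F G : ℕ → ℕ} (hF : Xadd F) (hG : Xadd G) : Xadd fun x => F x ^^^ G x := by
  intro x y; simp only [hG x y, hF x y]; ac_rfl
theorem Xadd.shl {F : ℕ → ℕ} (hF : Xadd F) (k : ℕ) : Xadd fun x => F x <<< k := by
  intro x y; simp only [hF x y, Nat.shiftLeft_xor_distrib]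
theorem Xadd.shr {F : ℕ → ℕ} (hF : Xadd F) (k : ℕ) : Xadd fun x => F x >>> k := by
  intro x y; simp only [hF x y, Nat.shiftRight_xor_distrib]
theorem Xadd.land {F : ℕ → ℕ} (hF : Xadd F) (k : ℕ) : Xadd fun x => F x &&& k := by
  intro x y; simp only [hF x y, Nat.and_xor_distrib_right]
theorem Xadd.id : Xadd fun x => x := fun _ _ => rfl
theorem Xadd.const0 : Xadd fun _ => 0 := by intro x y; simp
theorem Xadd.bitmul {F : ℕ → ℕ} (hF : Xadd F) (k c : ℕ) : Xadd fun x => ((F x >>> k) &&& 1) * c := by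
  intro x y
  have h := (hF.shr k).land 1 x y
  simp only at h
  simp only [h]
  have hx : (F x >>> k) &&& 1 < 2 := Nat.lt_of_le_of_lt Nat.and_le_right (by norm_num)
  have hy : (F y >>> k) &&& 1 < 2 := Nat.lt_of_le_of_lt Nat.and_le_right (by norm_num)
  generalize (F x >>> k) &&& 1 = a at hx
  generalize (F y >>> k) &&& 1 = b at hy
  interval_cases a <;> interval_cases b <;> simp

theorem Xadd.ext {F G : ℕ → ℕ} (hF : Xadd F) (hG : Xadd G) (n : ℕ)
    (h : ∀ k < n, F (2^k) = G (2^k)) : ∀ x < 2^n, F x = G x := by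
  induction n with
  | zero => intro x hx; have : x = 0 := by simpa using hx
            rw [this, hF.zero, hG.zero]
  | succ n ih =>
    intro x hx
    have ih' := ih fun k hk => h k (by omega)
    by_cases hlt : x < 2^n
    · exact ih' x hlt
    · have e : x = 2^n ^^^ (x - 2^n) := by
        have h1 : x - 2^n < 2^n := by rw [pow_succ] at hx; omega
        have h2 := Nat.two_pow_add_eq_or_of_lt h1 1
        have h3 : 2^n ^^^ (x - 2^n) = 2^n ||| (x - 2^n) := by
          apply Nat.eq_of_testBit_eq
          intro i
          rw [Nat.testBit_xor, Nat.testBit_or, Nat.testBit_two_pow]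
          by_cases hi : n = i
          · subst hi; rw [Nat.testBit_lt_two_pow h1]; simp
          · simp [hi]
        rw [h3]; rw [mul_one] at h2; omega
      rw [e, hF, hG, h n (by omega), ih' _ (by rw [pow_succ] at hx; omega)]

theorem lin_succ (C n x : ℕ) : lin C (n+1) x =
    lin C n x ^^^ (((x >>> n) &&& 1) * ((C >>> (128*n)) % 2^128)) := rfl
theorem lin_add (C n : ℕ) : Xadd (lin C n) := by
  induction n with
  | zero => exact Xadd.const0
  | succ n ih => exact ih.xor (Xadd.bitmul Xadd.id n _)
theorem lin_stable (C n x : ℕ) (hx : x < 2^n) (m : ℕ) : lin C (n+m) x = lin C n x := by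
  induction m with
  | zero => rfl
  | succ m ih =>
    rw [← Nat.add_assoc, lin_succ, ih]
    have : x >>> (n+m) = 0 := by
      rw [Nat.shiftRight_eq_div_pow]
      apply Nat.div_eq_of_lt
      exact lt_of_lt_of_le hx (Nat.pow_le_pow_right (by norm_num) (by omega))
    rw [this]; simp

theorem split_word (v : ℕ) : v = ((v >>> 6) <<< 6) ^^^ (v &&& 63) := by
  apply Nat.eq_of_testBit_eq
  intro i
  have h63 : (63 : ℕ) = 2^6 - 1 := by norm_num
  rw [Nat.testBit_xor, Nat.testBit_shiftLeft, Nat.testBit_shiftRight, Nat.testBit_and, h63,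
    Nat.testBit_two_pow_sub_one]
  by_cases h : i < 6
  · have h2 : ¬ 6 ≤ i := by omega
    simp [h, h2]
  · have : 6 + (i - 6) = i := by omega
    have h2 : 6 ≤ i := by omega
    simp [h, this, h2]
theorem W_eq (C v : ℕ) :
    W C (v >>> 6) (v &&& 63) = wt (17895697 ^^^ lin C 15 v) := by
  have e : W C (v >>> 6) (v &&& 63) =
    wt (17895697 ^^^ (lin C 15 ((v >>> 6) <<< 6) ^^^ lin C 6 (v &&& 63))) := rfl
  have hq : v &&& 63 < 2^6 := Nat.lt_of_le_of_lt Nat.and_le_right (by norm_num)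
  rw [e, ← lin_stable C 6 _ hq 9, ← lin_add C 15, ← split_word]

theorem fld_add (o n : ℕ) : Xadd fun K => fld K o n := (Xadd.id.shr o).land n
theorem fld_lt (K o n : ℕ) : fld K o n ≤ n := Nat.and_le_right
theorem fld_key (K v o : ℕ) (h : fld K o 32767 = v) : fld K (o+6) 511 = v >>> 6 := by
  subst h
  change (K >>> (o+6)) &&& 511 = ((K >>> o) &&& 32767) >>> 6
  rw [Nat.shiftRight_and_distrib, ← Nat.shiftRight_add]
  rfl
theorem fld_q (K v o : ℕ) (h : fld K o 32767 = v) : fld K o 63 = v &&& 63 := by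
  subst h
  change (K >>> o) &&& 63 = ((K >>> o) &&& 32767) &&& 63
  rw [Nat.and_assoc]
  rfl
theorem wtAt_eq (C K o v : ℕ) (h : fld K o 32767 = v) :
    wtAt C K o = W C (v >>> 6) (v &&& 63) := by
  unfold wtAt
  have e : Nat.add o 6 = o + 6 := rfl
  rw [forceN_eq, forceN_eq, nadd_zero, e, fld_key _ _ _ h, fld_q _ _ _ h]

theorem stage3_sound {C K s v4 v5 v6 : ℕ} (h : stage3 C K s = true)
    (e4 : fld K 0 32767 = v4) (e5 : fld K 15 32767 = v5) (e6 : fld K 60 32767 = v6)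
    (ed : K >>> 75 = 0)
    (b4 : s + W C (v4 >>> 6) (v4 &&& 63) ≤ 15)
    (b5 : s + W C (v4 >>> 6) (v4 &&& 63) + W C (v5 >>> 6) (v5 &&& 63) ≤ 18)
    (b6 : s + W C (v4 >>> 6) (v4 &&& 63) + W C (v5 >>> 6) (v5 &&& 63)
      + W C (v6 >>> 6) (v6 &&& 63) ≤ 22) : False := by
  unfold stage3 at h
  rw [force_eq, force_eq, wtAt_eq C K 0 v4 e4, wtAt_eq C K 15 v5 e5, wtAt_eq C K 60 v6 e6] at h
  simp only [ite2_eq, Nat.ble_eq, Nat.add_eq] at h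
  rw [if_neg (by omega), if_neg (by omega), if_neg (by omega)] at h
  have h1 : 1 ≤ K >>> 75 := Nat.le_of_ble_eq_true h
  omega

theorem vec_eq (C T o K : ℕ) : vec C T o (fld K o 511) =
    pack 8 (fun t => mw C (fld (K ^^^ lin T 6 t) o 511)) 64 := by
  unfold vec
  congr 1
  funext t
  have := fld_add o 511 K (lin T 6 t)
  simp only at this
  have e : ∀ x y : ℕ, Nat.xor x y = x ^^^ y := fun _ _ => rfl
  rw [forceN_eq, nadd_zero, this, e]

theorem search_sound {C B0 B1 T Q2 Q3 : ℕ} {reps : List ℕ}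
    (h : stage0 C B0 B1 T Q2 Q3 reps = true) (v : ℕ → ℕ) (hv : ∀ i, v i < 2^15) (K : ℕ)
    (hK : K = lin B0 15 (v 0) ^^^ lin B1 15 (v 1) ^^^ lin T 6 ((v 2 >>> 6) &&& 63) ^^^
      lin Q2 6 (v 2 &&& 63) ^^^ lin Q3 6 (v 3 &&& 63))
    (e4 : fld K 0 32767 = v 4) (e5 : fld K 15 32767 = v 5) (e2 : fld K 30 32767 = v 2)
    (e3 : fld K 45 32767 = v 3) (e6 : fld K 60 32767 = v 6) (ed : K >>> 75 = 0)
    (hQ2 : ∀ q < 64, ∀ o ∈ [36, 51, 6, 21, 66], fld (lin Q2 6 q) o 511 = 0)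
    (hQ3 : ∀ q < 64, ∀ o ∈ [36, 51, 6, 21, 66], fld (lin Q3 6 q) o 511 = 0)
    (h0 : v 0 ∈ reps) (w : ℕ → ℕ) (hw : ∀ i < 7, w i = wt (17895697 ^^^ lin C 15 (v i)))
    (b1 : w 0 + w 1 ≤ 6) (b2 : w 0 + w 1 + w 2 ≤ 9) (b3 : w 0 + w 1 + w 2 + w 3 ≤ 12)
    (b4 : w 0 + w 1 + w 2 + w 3 + w 4 ≤ 15) (b5 : w 0 + w 1 + w 2 + w 3 + w 4 + w 5 ≤ 18)
    (b6 : w 0 + w 1 + w 2 + w 3 + w 4 + w 5 + w 6 ≤ 22) : False := by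
  have hw' : ∀ i < 7, W C (v i >>> 6) (v i &&& 63) = w i := by
    intro i hi; rw [W_eq, hw i hi]
  have q63 : ∀ x : ℕ, x &&& 63 < 64 := fun x => Nat.lt_of_le_of_lt Nat.and_le_right (by norm_num)
  unfold stage0 at h
  have h := allL_true h _ h0
  rw [force_eq, force_eq] at h
  have h := allN_true h (v 1 >>> 6) (by
    rw [Nat.shiftRight_eq_div_pow]; have := hv 1; omega)
  have e0 : W C (Nat.shiftRight (v 0) 6) (Nat.land (v 0) 63) = w 0 := hw' 0 (by norm_num)
  rw [e0] at h
  have h := allL_true h (v 1 &&& 63) (mem_qs (q63 _) (by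
    rw [hw' 1 (by norm_num)]; change w 1 ≤ 6 - w 0; omega))
  rw [force_eq, force_eq, hw' 1 (by norm_num)] at h
  have ev1 : Nat.add (Nat.mul (v 1 >>> 6) 64) (v 1 &&& 63) = v 1 := by
    change (v 1 >>> 6) * 64 + (v 1 &&& 63) = v 1
    have h63 : (63 : ℕ) = 2^6 - 1 := by norm_num
    rw [Nat.shiftRight_eq_div_pow, h63, Nat.and_two_pow_sub_one_eq_mod]
    omega
  rw [ev1] at h
  have h : stage1 C T Q2 Q3 (lin B0 15 (v 0) ^^^ lin B1 15 (v 1)) (w 0 + w 1) = true := h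
  generalize hK1 : lin B0 15 (v 0) ^^^ lin B1 15 (v 1) = K1 at h hK
  set t := (v 2 >>> 6) &&& 63 with ht
  -- key fields are already determined before the `Q` contributions
  have key : ∀ o ∈ [36, 51, 6, 21, 66], fld (K1 ^^^ lin T 6 t) o 511 = fld K o 511 ∧
      fld (K1 ^^^ lin T 6 t ^^^ lin Q2 6 (v 2 &&& 63)) o 511 = fld K o 511 := by
    intro o ho
    have a1 := fld_add o 511 (K1 ^^^ lin T 6 t ^^^ lin Q2 6 (v 2 &&& 63)) (lin Q3 6 (v 3 &&& 63))
    have a2 := fld_add o 511 (K1 ^^^ lin T 6 t) (lin Q2 6 (v 2 &&& 63))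
    simp only at a1 a2
    rw [hQ3 _ (q63 _) o ho, Nat.xor_zero, ← hK] at a1
    rw [hQ2 _ (q63 _) o ho, Nat.xor_zero] at a2
    exact ⟨a2.symm.trans a1.symm, a1.symm⟩
  have k2 : fld K 36 511 = v 2 >>> 6 := fld_key K _ 30 e2
  have k3 : fld K 51 511 = v 3 >>> 6 := fld_key K _ 45 e3
  have k4 : fld K 6 511 = v 4 >>> 6 := fld_key K _ 0 e4
  have k5 : fld K 21 511 = v 5 >>> 6 := fld_key K _ 15 e5
  have k6 : fld K 66 511 = v 6 >>> 6 := fld_key K _ 60 e6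
  have mwle : ∀ i < 7, mw C (v i >>> 6) ≤ w i := by
    intro i hi; rw [← hw' i hi]; exact mw_le _ _ _ (q63 _)
  unfold stage1 at h
  rw [force_eq, force_eq, force_eq, force_eq, force_eq, vec_eq, vec_eq, vec_eq, vec_eq, vec_eq] at h
  have m2 := mwle 2 (by norm_num)
  have m3 := mwle 3 (by norm_num)
  have m4 := mwle 4 (by norm_num)
  have m5 := mwle 5 (by norm_num)
  have m6 := mwle 6 (by norm_num)
  have h := desc_true 6 _ _ h t (q63 _) (by
    apply msk2_bit
    · intro k; exact mw_le7 _ _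
    · intro k; exact mw_le7 _ _
    · intro k; exact mw_le7 _ _
    · intro k; exact mw_le7 _ _
    · intro k; exact mw_le7 _ _
    · exact q63 _
    all_goals
      simp only [(key 36 (by decide)).1, (key 51 (by decide)).1, (key 6 (by decide)).1,
        (key 21 (by decide)).1, (key 66 (by decide)).1, k2, k3, k4, k5, k6]
      omega)
  rw [Nat.zero_add, force_eq] at h
  have h : stage2 C Q2 Q3 (K1 ^^^ lin T 6 t) (w 0 + w 1) = true := h
  unfold stage2 at h
  rw [force_eq, (key 36 (by decide)).1, k2] at h
  have h := allL_true h (v 2 &&& 63) (mem_qs (q63 _) (by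
    rw [hw' 2 (by norm_num)]; change w 2 ≤ 9 - (w 0 + w 1); omega))
  rw [force_eq, force_eq, hw' 2 (by norm_num)] at h
  have h : stage2b C Q3 (K1 ^^^ lin T 6 t ^^^ lin Q2 6 (v 2 &&& 63)) (w 0 + w 1 + w 2) = true := h
  unfold stage2b at h
  rw [force_eq, (key 51 (by decide)).2, k3] at h
  have h := allL_true h (v 3 &&& 63) (mem_qs (q63 _) (by
    rw [hw' 3 (by norm_num)]; change w 3 ≤ 12 - (w 0 + w 1 + w 2); omega))
  rw [force_eq, force_eq, hw' 3 (by norm_num)] at h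
  have h : stage3 C (K1 ^^^ lin T 6 t ^^^ lin Q2 6 (v 2 &&& 63) ^^^ lin Q3 6 (v 3 &&& 63))
    (w 0 + w 1 + w 2 + w 3) = true := h
  rw [← hK] at h
  refine stage3_sound h e4 e5 e6 ed ?_ ?_ ?_
  all_goals
    rw [hw' 4 (by norm_num)]
    try rw [hw' 5 (by norm_num)]
    try rw [hw' 6 (by norm_num)]
    omega


/-! ### Row weights -/

/-- indicator of being nonzero -/
def nz (x : ℕ) : ℕ := if x = 0 then 0 else 1

theorem and_step (z m : ℕ) : z &&& (16*m+1) = 16 * ((z >>> 4) &&& m) + (z &&& 1) := by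
  have h1 := Nat.div_add_mod (z &&& (16*m+1)) 16
  have h2 : (z &&& (16*m+1)) / 16 = (z >>> 4) &&& m := by
    have := Nat.shiftRight_and_distrib (a := z) (b := 16*m+1) (i := 4)
    rw [Nat.shiftRight_eq_div_pow (m := z &&& (16*m+1)), Nat.shiftRight_eq_div_pow (m := 16*m+1)] at this
    have e : (16*m+1) / 2^4 = m := by omega
    rw [e] at this
    exact this
  have h3 : (z &&& (16*m+1)) % 16 = z &&& 1 := by
    have := Nat.and_mod_two_pow (a := z) (b := 16*m+1) (n := 4)
    have e : (16*m+1) % 2^4 = 1 := by omega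
    rw [e] at this
    have e2 : z % 2^4 &&& 1 = z &&& 1 := by
      rw [Nat.and_one_is_mod, Nat.and_one_is_mod]; omega
    rw [e2] at this
    exact this
  omega

theorem nib (x : ℕ) : ((x ||| (x >>> 1)) ||| (x >>> 2)) &&& 1 = nz (x &&& 7) := by
  have h : (((x ||| (x >>> 1)) ||| (x >>> 2)) &&& 1) =
      (((x &&& 7) ||| ((x &&& 7) >>> 1)) ||| ((x &&& 7) >>> 2)) &&& 1 := by
    apply Nat.eq_of_testBit_eq
    intro i
    have h7 : (7 : ℕ) = 2^3 - 1 := by norm_num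
    rw [h7]
    simp only [Nat.testBit_and, Nat.testBit_or, Nat.testBit_shiftRight,
      Nat.testBit_two_pow_sub_one]
    by_cases hi : i < 1
    · have : i = 0 := by omega
      subst this; simp
    · have h1 : Nat.testBit 1 i = false :=
        Nat.testBit_lt_two_pow (Nat.one_lt_two_pow (by omega))
      simp [h1]
  rw [h]
  have hx : x &&& 7 < 8 := Nat.lt_of_le_of_lt Nat.and_le_right (by norm_num)
  generalize x &&& 7 = y at hx
  interval_cases y <;> rfl

theorem wt_eq (x : ℕ) : wt x = ∑ j ∈ Finset.range 7, nz ((x >>> (4*j)) &&& 7) := by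
  have e : wt x = (((x ||| (x >>> 1)) ||| (x >>> 2)) &&& 17895697) % 15 := rfl
  have sh : ∀ a b : ℕ, (((x ||| (x >>> 1)) ||| (x >>> 2)) >>> a) &&& 1 = nz ((x >>> a) &&& 7) := by
    intro a b
    rw [Nat.shiftRight_or_distrib, Nat.shiftRight_or_distrib, ← nib, ← Nat.shiftRight_add,
      ← Nat.shiftRight_add, ← Nat.shiftRight_add, ← Nat.shiftRight_add, Nat.add_comm 1,
      Nat.add_comm 2]
  have n1 : ∀ y, nz y ≤ 1 := by intro y; unfold nz; split_ifs <;> omega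
  rw [e]
  generalize hz : ((x ||| (x >>> 1)) ||| (x >>> 2)) = z at sh
  have s0 : z &&& 17895697 = 16 * ((z >>> 4) &&& 1118481) + (z &&& 1) := and_step z 1118481
  have s1 := and_step (z >>> 4) 69905
  have s2 := and_step (z >>> 8) 4369
  have s3 := and_step (z >>> 12) 273
  have s4 := and_step (z >>> 16) 17
  have s5 := and_step (z >>> 20) 1
  rw [← Nat.shiftRight_add] at s1 s2 s3 s4 s5
  simp only [Finset.sum_range_succ, Finset.sum_range_zero]
  have c0 : z &&& 1 = nz ((x >>> 0) &&& 7) := sh 0 0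
  have s1 : z >>> 4 &&& 1118481 = 16 * (z >>> 8 &&& 69905) + (z >>> 4 &&& 1) := s1
  have s2 : z >>> 8 &&& 69905 = 16 * (z >>> 12 &&& 4369) + (z >>> 8 &&& 1) := s2
  have s3 : z >>> 12 &&& 4369 = 16 * (z >>> 16 &&& 273) + (z >>> 12 &&& 1) := s3
  have s4 : z >>> 16 &&& 273 = 16 * (z >>> 20 &&& 17) + (z >>> 16 &&& 1) := s4
  have s5 : z >>> 20 &&& 17 = 16 * (z >>> 24 &&& 1) + (z >>> 20 &&& 1) := s5
  rw [s0, s1, s2, s3, s4, s5, c0, sh 4 0, sh 8 0, sh 12 0, sh 16 0, sh 20 0, sh 24 0]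
  change _ = 0 + nz ((x >>> 0) &&& 7) + nz ((x >>> 4) &&& 7) + nz ((x >>> 8) &&& 7) +
    nz ((x >>> 12) &&& 7) + nz ((x >>> 16) &&& 7) + nz ((x >>> 20) &&& 7) + nz ((x >>> 24) &&& 7)
  have m0 := n1 ((x >>> 0) &&& 7)
  have m1 := n1 ((x >>> 4) &&& 7)
  have m2 := n1 ((x >>> 8) &&& 7)
  have m3 := n1 ((x >>> 12) &&& 7)
  have m4 := n1 ((x >>> 16) &&& 7)
  have m5 := n1 ((x >>> 20) &&& 7)
  have m6 := n1 ((x >>> 24) &&& 7)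
  clear s0 s1 s2 s3 s4 s5 c0 sh hz
  generalize nz ((x >>> 0) &&& 7) = y0 at *
  generalize nz ((x >>> 4) &&& 7) = y1 at *
  generalize nz ((x >>> 8) &&& 7) = y2 at *
  generalize nz ((x >>> 12) &&& 7) = y3 at *
  generalize nz ((x >>> 16) &&& 7) = y4 at *
  generalize nz ((x >>> 20) &&& 7) = y5 at *
  generalize nz ((x >>> 24) &&& 7) = y6 at *
  omega

/-! ### Arithmetic of the field with eight elements on 3-bit words -/

/-- multiplication by the generator -/
def mula (x : ℕ) : ℕ :=
  ((x &&& 3) <<< 1) ^^^ (((x >>> 2) &&& 1) * 3)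
/-- multiplication by a power of the generator -/
def mulp (x e : ℕ) : ℕ := @Nat.rec (fun _ => ℕ) x (fun _ ih => mula ih) (e % 7)
def dig (φ s : ℕ) : ℕ := (φ >>> (3*s)) &&& 7

/-- a monomial: coefficient index, exponent, class, position in the row word -/
structure Mon where
  s : ℕ
  a : ℕ
  c : ℕ
  h : ℕ

def xsum (D : List Mon) (F : Mon → ℕ) : ℕ := D.foldr (fun m r => F m ^^^ r) 0
def ev (D : List Mon) (φ i j : ℕ) : ℕ := xsum D fun m => mulp (dig φ m.s) (m.a*i + m.c*j)
def rowV (D : List Mon) (φ i : ℕ) : ℕ := xsum D fun m => (mulp (dig φ m.s) (m.a*i)) <<< m.h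
def rowR (D : List Mon) (φ j : ℕ) : ℕ := xsum D fun m => (mulp (dig φ m.s) (m.c*j)) <<< m.h

theorem mula_add : Xadd mula :=
  ((Xadd.id.land 3).shl 1).xor (Xadd.bitmul Xadd.id 2 3)
theorem mulp_add (e : ℕ) : Xadd fun x => mulp x e := by
  unfold mulp
  induction e % 7 with
  | zero => exact Xadd.id
  | succ n ih => exact mula_add.comp ih
theorem dig_add (s : ℕ) : Xadd fun φ => dig φ s := (Xadd.id.shr _).land _
theorem xsum_add (D : List Mon) (F : Mon → ℕ → ℕ) (h : ∀ m, Xadd (F m)) :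
    Xadd fun φ => xsum D fun m => F m φ := by
  induction D with
  | nil => exact Xadd.const0
  | cons m D ih => exact (h m).xor ih
theorem ev_add (D : List Mon) (i j : ℕ) : Xadd fun φ => ev D φ i j :=
  xsum_add D (fun m φ => mulp (dig φ m.s) (m.a*i + m.c*j)) fun m => (mulp_add _).comp (dig_add _)
theorem rowV_add (D : List Mon) (i : ℕ) : Xadd fun φ => rowV D φ i :=
  xsum_add D (fun m φ => (mulp (dig φ m.s) (m.a*i)) <<< m.h)
    fun m => ((mulp_add _).comp (dig_add _)).shl _
theorem rowR_add (D : List Mon) (j : ℕ) : Xadd fun φ => rowR D φ j :=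
  xsum_add D (fun m φ => (mulp (dig φ m.s) (m.c*j)) <<< m.h)
    fun m => ((mulp_add _).comp (dig_add _)).shl _
theorem xsum_congr {D : List Mon} {F G : Mon → ℕ} (h : ∀ m ∈ D, F m = G m) :
    xsum D F = xsum D G := by
  induction D with
  | nil => rfl
  | cons m D ih =>
    change F m ^^^ xsum D F = G m ^^^ xsum D G
    rw [h m List.mem_cons_self, ih fun m hm => h m (List.mem_cons_of_mem _ hm)]
theorem dig_lt (φ s : ℕ) : dig φ s < 8 := Nat.lt_of_le_of_lt Nat.and_le_right (by norm_num)
theorem mula_lt (x : ℕ) (hx : x < 8) : mula x < 8 := by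
  interval_cases x <;> decide
theorem mulp_lt (x e : ℕ) (hx : x < 8) : mulp x e < 8 := by
  unfold mulp
  induction e % 7 with
  | zero => exact hx
  | succ n ih => exact mula_lt _ ih
theorem xsum_lt (D : List Mon) (F : Mon → ℕ) (h : ∀ m, F m < 8) : xsum D F < 8 := by
  induction D with
  | nil => exact (by norm_num : 0 < 8)
  | cons m D ih => exact Nat.xor_lt_two_pow (n := 3) (h m) ih
theorem ev_lt (D : List Mon) (φ i j : ℕ) : ev D φ i j < 8 :=
  xsum_lt D _ fun m => mulp_lt _ _ (dig_lt _ _)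

/-- the columns `C` expand row words to rows of values -/
def ChkRow (D : List Mon) (C n : ℕ) : Prop :=
  ∀ k < 51, ∀ i < 7, rowV D (2^k) i < 2^n ∧
    ∀ j < 7, ((lin C n (rowV D (2^k) i)) >>> (4*j)) &&& 7 = ev D (2^k) i j

theorem rowV_lt {D : List Mon} {C n : ℕ} (h : ChkRow D C n) (φ : ℕ) (hφ : φ < 2^51) (i : ℕ)
    (hi : i < 7) : rowV D φ i < 2^n := by
  have := Xadd.ext (rowV_add D i) ((rowV_add D i).land (2^n-1)) 51 (by
    intro k hk
    change rowV D (2^k) i = rowV D (2^k) i &&& (2^n-1)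
    rw [Nat.and_two_pow_sub_one_eq_mod, Nat.mod_eq_of_lt (h k hk i hi).1]) φ hφ
  have this : rowV D φ i = rowV D φ i &&& (2^n-1) := this
  rw [this, Nat.and_two_pow_sub_one_eq_mod]
  exact Nat.mod_lt _ (by positivity)
theorem row_nib {D : List Mon} {C n : ℕ} (h : ChkRow D C n) (φ : ℕ) (hφ : φ < 2^51) (i j : ℕ)
    (hi : i < 7) (hj : j < 7) : ((lin C n (rowV D φ i)) >>> (4*j)) &&& 7 = ev D φ i j :=
  Xadd.ext ((((lin_add C n).comp (rowV_add D i)).shr (4*j)).land 7) (ev_add D i j) 51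
    (fun k hk => (h k hk i hi).2 j hj) φ hφ
theorem row_wt1 {D : List Mon} {C n : ℕ} (h : ChkRow D C n) (φ : ℕ) (hφ : φ < 2^51) (i : ℕ)
    (hi : i < 7) : wt (17895697 ^^^ lin C n (rowV D φ i)) =
      ∑ j ∈ Finset.range 7, nz (1 ^^^ ev D φ i j) := by
  rw [wt_eq]
  apply Finset.sum_congr rfl
  intro j hj
  have hj : j < 7 := Finset.mem_range.mp hj
  rw [Nat.shiftRight_xor_distrib, Nat.and_xor_distrib_right, row_nib h φ hφ i j hi hj]
  interval_cases j <;> rfl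
theorem row_wt0 {D : List Mon} {C n : ℕ} (h : ChkRow D C n) (φ : ℕ) (hφ : φ < 2^51) (i : ℕ)
    (hi : i < 7) : wt (lin C n (rowV D φ i)) = ∑ j ∈ Finset.range 7, nz (ev D φ i j) := by
  rw [wt_eq]
  apply Finset.sum_congr rfl
  intro j hj
  rw [row_nib h φ hφ i j hi (Finset.mem_range.mp hj)]


/-! ### The field with eight elements -/

theorem two_eq : (2 : F8) = 0 := CharTwo.two_eq_zero

theorem card_F8 : Nat.card F8 = 8 := by
  rw [GaloisField.card 2 3 (by norm_num)]; norm_num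

instance : Finite F8 := Nat.finite_of_card_ne_zero (by rw [card_F8]; norm_num)

theorem pow_seven (x : F8) (hx : x ≠ 0) : x^7 = 1 := by
  have : Fintype F8 := Fintype.ofFinite F8
  have h := FiniteField.pow_card_sub_one_eq_one x hx
  rwa [Fintype.card_eq_nat_card, card_F8] at h

theorem exists_gen : ∃ α : F8, α^3 = α + 1 := by
  classical
  have : ∃ β : F8, β ≠ 0 ∧ β ≠ 1 := by
    by_contra hcon
    push Not at hcon
    have : Function.Injective (fun x : F8 => if x = 0 then (0 : Fin 2) else 1) := by
      intro x y hxy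
      by_cases hx : x = 0 <;> by_cases hy : y = 0 <;> simp [hx, hy] at hxy ⊢
      rw [hcon x hx, hcon y hy]
    have h := Nat.card_le_card_of_injective _ this
    rw [card_F8] at h
    simp at h
  obtain ⟨β, h0, h1⟩ := this
  have h7 := pow_seven β h0
  have hf : (β - 1) * ((β^3+β+1) * (β^3+β^2+1)) = 0 := by
    linear_combination h7 + (β^4 - β^3) * two_eq
  rcases mul_eq_zero.mp hf with h | h
  · exact absurd (sub_eq_zero.mp h) h1
  · rcases mul_eq_zero.mp h with h | h
    · exact ⟨β, by linear_combination h - (β + 1) * two_eq⟩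
    · refine ⟨β⁻¹, ?_⟩
      field_simp
      linear_combination - h + (β^3 + β^2 + 1) * two_eq - (β^3 + β^2) * two_eq

section gen
variable {α : F8}

/-- the element of `F8` encoded by a 3-bit word -/
def dec (α : F8) (x : ℕ) : F8 :=
  (if x.testBit 0 then 1 else 0) + (if x.testBit 1 then α else 0) +
    (if x.testBit 2 then α^2 else 0)

theorem dec_xor (α : F8) (x y : ℕ) : dec α (x ^^^ y) = dec α x + dec α y := by
  unfold dec
  simp only [Nat.testBit_xor]
  have h := two_eq
  cases x.testBit 0 <;> cases x.testBit 1 <;> cases x.testBit 2 <;>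
  cases y.testBit 0 <;> cases y.testBit 1 <;> cases y.testBit 2 <;>
  simp <;> grind
theorem dec_zero (α : F8) : dec α 0 = 0 := by simp [dec]
theorem dec_one (α : F8) : dec α 1 = 1 := by simp [dec, Nat.testBit]
theorem gen_ne (hα : α^3 = α + 1) : α ≠ 0 := by
  rintro rfl; simp at hα
theorem gen_pow (hα : α^3 = α + 1) : α^7 = 1 := pow_seven α (gen_ne hα)
theorem gen_mod (hα : α^3 = α + 1) {m n : ℕ} (h : m % 7 = n % 7) : α^m = α^n := by
  rw [pow_eq_pow_mod m (gen_pow hα), pow_eq_pow_mod n (gen_pow hα), h]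
theorem dec_mula (hα : α^3 = α + 1) (x : ℕ) (hx : x < 8) : dec α (mula x) = α * dec α x := by
  have h := two_eq
  interval_cases x <;> simp [dec, mula, Nat.testBit] <;> grind
theorem dec_mulp (hα : α^3 = α + 1) (x e : ℕ) (hx : x < 8) :
    dec α (mulp x e) = α^e * dec α x := by
  rw [pow_eq_pow_mod e (gen_pow hα)]
  have : ∀ n, (@Nat.rec (fun _ => ℕ) x (fun _ ih => mula ih) n : ℕ) < 8 ∧
      dec α (@Nat.rec (fun _ => ℕ) x (fun _ ih => mula ih) n) = α^n * dec α x := by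
    intro n
    induction n with
    | zero => exact ⟨hx, by simp⟩
    | succ n ih =>
      refine ⟨mula_lt _ ih.1, ?_⟩
      change dec α (mula _) = _
      rw [dec_mula hα _ ih.1, ih.2, pow_succ]; ring
  exact (this (e % 7)).2
theorem eq_mulp (x : ℕ) (h0 : x ≠ 0) (hx : x < 8) : ∃ e < 7, x = mulp 1 e := by
  revert h0 hx
  have : ∀ x < 8, x ≠ 0 → ∃ e < 7, x = mulp 1 e := by decide
  intro h0 hx; exact this x hx h0
theorem dec_ne (hα : α^3 = α + 1) (x : ℕ) (h0 : x ≠ 0) (hx : x < 8) : dec α x ≠ 0 := by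
  obtain ⟨e, -, rfl⟩ := eq_mulp x h0 hx
  rw [dec_mulp hα 1 e (by norm_num), dec_one, mul_one]
  exact pow_ne_zero _ (gen_ne hα)
theorem dec_inj (hα : α^3 = α + 1) (x y : ℕ) (hx : x < 8) (hy : y < 8)
    (h : dec α x = dec α y) : x = y := by
  by_contra hne
  refine dec_ne hα (x ^^^ y) ?_ (Nat.xor_lt_two_pow (n := 3) hx hy) ?_
  · intro h0; exact hne (Nat.xor_eq_zero_iff.mp h0)
  · rw [dec_xor, h]; exact CharTwo.add_self_eq_zero _
theorem dec_surj (hα : α^3 = α + 1) (z : F8) : ∃ x < 8, dec α x = z := by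
  have inj : Function.Injective (fun x : Fin 8 => dec α x) := by
    intro x y h; exact Fin.ext (dec_inj hα _ _ x.2 y.2 h)
  have bij := inj.bijective_of_nat_card_le (by rw [card_F8]; simp)
  obtain ⟨x, hx⟩ := bij.2 z
  exact ⟨x, x.2, hx⟩
theorem eq_pow (hα : α^3 = α + 1) (z : F8) (hz : z ≠ 0) : ∃ e < 7, z = α^e := by
  obtain ⟨x, hx, rfl⟩ := dec_surj hα z
  obtain ⟨e, he, rfl⟩ := eq_mulp x (by rintro rfl; exact hz (dec_zero α)) hx
  exact ⟨e, he, by rw [dec_mulp hα 1 e (by norm_num), dec_one, mul_one]⟩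

theorem dig_eq (φ s : ℕ) : dig φ s = φ / 8^s % 8 := by
  unfold dig
  have h7 : (7 : ℕ) = 2^3 - 1 := by norm_num
  rw [h7, Nat.and_two_pow_sub_one_eq_mod, Nat.shiftRight_eq_div_pow, pow_mul]
  norm_num
/-- every coefficient vector is encoded by a word -/
theorem exists_word (hα : α^3 = α + 1) (f : ℕ → F8) (n : ℕ) :
    ∃ φ < 8^n, ∀ s < n, dec α (dig φ s) = f s := by
  induction n with
  | zero => exact ⟨0, by norm_num, fun s hs => by omega⟩
  | succ n ih =>
    obtain ⟨φ, hφ, h⟩ := ih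
    obtain ⟨x, hx, hxf⟩ := dec_surj hα (f n)
    refine ⟨φ + 8^n * x, ?_, ?_⟩
    · rw [pow_succ]; nlinarith [Nat.mul_le_mul_left (8^n) (Nat.lt_succ_iff.mp hx : x ≤ 7)]
    · intro s hs
      rw [dig_eq]
      rcases Nat.lt_succ_iff_lt_or_eq.mp hs with hs | rfl
      · rw [← h s hs, dig_eq]
        congr 1
        obtain ⟨d, rfl⟩ : ∃ d, n = s + 1 + d := ⟨n - (s+1), by omega⟩
        have : 8^(s+1+d) * x = 8^s * (8 * (8^d * x)) := by rw [pow_add, pow_succ]; ring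
        rw [this, Nat.add_mul_div_left _ _ (by positivity), Nat.add_mul_mod_self_left]
      · rw [Nat.add_mul_div_left _ _ (by positivity), Nat.div_eq_of_lt hφ, Nat.zero_add,
          Nat.mod_eq_of_lt hx, hxf]

/-- indicator of being nonzero -/
def nzF (x : F8) : ℕ := open Classical in if x = 0 then 0 else 1
theorem nzF_dec (hα : α^3 = α + 1) (x : ℕ) (hx : x < 8) : nzF (dec α x) = nz x := by
  unfold nzF nz
  by_cases h : x = 0
  · subst h; simp [dec_zero]
  · rw [if_neg h, if_neg (dec_ne hα x h hx)]
theorem nzF_mul (x y : F8) (hx : x ≠ 0) : nzF (x * y) = nzF y := by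
  unfold nzF
  by_cases h : y = 0
  · simp [h]
  · rw [if_neg h, if_neg (mul_ne_zero hx h)]

/-- value of `c0 + Σ f_m α^(a i + c j)` -/
def G (α : F8) (D : List Mon) (c0 : F8) (f : ℕ → F8) (i j : ℕ) : F8 :=
  c0 + (D.map fun m => f m.s * α^(m.a*i + m.c*j)).sum
def wF (α : F8) (D : List Mon) (c0 : F8) (f : ℕ → F8) (i : ℕ) : ℕ :=
  ∑ j ∈ Finset.range 7, nzF (G α D c0 f i j)

theorem dec_xsum (α : F8) (D : List Mon) (F : Mon → ℕ) :
    dec α (xsum D F) = (D.map fun m => dec α (F m)).sum := by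
  induction D with
  | nil => exact dec_zero α
  | cons m D ih =>
    change dec α (F m ^^^ xsum D F) = _
    rw [dec_xor, ih]; simp
theorem dec_ev (hα : α^3 = α + 1) (D : List Mon) (hD : ∀ m ∈ D, m.s < 17) (f : ℕ → F8) (φ : ℕ)
    (h : ∀ s < 17, dec α (dig φ s) = f s) (i j : ℕ) :
    dec α (ev D φ i j) = (D.map fun m => f m.s * α^(m.a*i + m.c*j)).sum := by
  unfold ev
  rw [dec_xsum]
  congr 1
  apply List.map_congr_left
  intro m hm
  rw [dec_mulp hα _ _ (dig_lt _ _), h _ (hD m hm), mul_comm]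
theorem wF1 (hα : α^3 = α + 1) (D : List Mon) (hD : ∀ m ∈ D, m.s < 17) (f : ℕ → F8) (φ : ℕ)
    (h : ∀ s < 17, dec α (dig φ s) = f s) (i : ℕ) :
    wF α D 1 f i = ∑ j ∈ Finset.range 7, nz (1 ^^^ ev D φ i j) := by
  apply Finset.sum_congr rfl
  intro j _
  rw [← nzF_dec hα _ (Nat.xor_lt_two_pow (n := 3) (by norm_num) (ev_lt D φ i j)), dec_xor, dec_one,
    dec_ev hα D hD f φ h]
  rfl
theorem wF0 (hα : α^3 = α + 1) (D : List Mon) (hD : ∀ m ∈ D, m.s < 17) (f : ℕ → F8) (φ : ℕ)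
    (h : ∀ s < 17, dec α (dig φ s) = f s) (i : ℕ) :
    wF α D 0 f i = ∑ j ∈ Finset.range 7, nz (ev D φ i j) := by
  apply Finset.sum_congr rfl
  intro j _
  rw [← nzF_dec hα _ (ev_lt D φ i j), dec_ev hα D hD f φ h]
  simp [G]

end gen

/-! ### Cyclic rotation of a periodic sequence -/

theorem sum_range7_shift (g : ℕ → ℕ) (hg : ∀ i, g (i+7) = g i) (i0 : ℕ) :
    ∑ i ∈ Finset.range 7, g (i0 + i) = ∑ i ∈ Finset.range 7, g i := by
  induction i0 with
  | zero => simp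
  | succ n ih =>
    rw [← ih]
    simp only [Finset.sum_range_succ, Finset.sum_range_zero]
    have := hg n
    have e : ∀ k, n + 1 + k = n + (k+1) := by intro k; omega
    simp only [e]
    norm_num
    omega

theorem cycle (w : ℕ → ℕ) (hw : ∀ i, w (i+7) = w i) (hs : ∑ i ∈ Finset.range 7, w i ≤ 22) :
    ∃ i0 < 7, ∀ k ≤ 7, 7 * ∑ i ∈ Finset.range k, w (i0 + i) ≤ 22 * k := by
  let g : ℕ → ℤ := fun k => 7 * ((∑ i ∈ Finset.range k, w i : ℕ) : ℤ) - 22 * k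
  obtain ⟨i0, hi0, hmax⟩ := Finset.exists_max_image (Finset.range 7) g ⟨0, by simp⟩
  have split : ∀ a k, ∑ i ∈ Finset.range (a + k), w i =
      ∑ i ∈ Finset.range a, w i + ∑ i ∈ Finset.range k, w (a + i) := by
    intro a k; exact Finset.sum_range_add w a k
  have g7 : ∀ n, g (n+7) ≤ g n := by
    intro n
    have h1 := split n 7
    rw [sum_range7_shift w hw n] at h1
    simp only [g]
    rw [h1]; push_cast; push_cast at hs
    have : ((∑ i ∈ Finset.range 7, w i : ℕ) : ℤ) ≤ 22 := by exact_mod_cast hs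
    push_cast at this
    linarith
  refine ⟨i0, Finset.mem_range.mp hi0, ?_⟩
  intro k hk
  have hi := Finset.mem_range.mp hi0
  have hg : g (i0 + k) ≤ g i0 := by
    by_cases hlt : i0 + k < 7
    · exact hmax _ (Finset.mem_range.mpr hlt)
    · have h1 := g7 (i0 + k - 7)
      have e : i0 + k - 7 + 7 = i0 + k := by omega
      rw [e] at h1
      by_cases hlt2 : i0 + k - 7 < 7
      · exact h1.trans (hmax _ (Finset.mem_range.mpr hlt2))
      · omega
  simp only [g] at hg
  rw [split i0 k] at hg
  push_cast at hg
  zify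
  linarith


/-! ### Soundness of one search -/

/-- the word of five rows -/
def packK (D : List Mon) (φ : ℕ) : ℕ :=
  rowV D φ 4 ^^^ ((rowV D φ 5 ^^^ ((rowV D φ 2 ^^^ ((rowV D φ 3 ^^^ (rowV D φ 6 <<< 15))
    <<< 15)) <<< 15)) <<< 15)
theorem packK_add (D : List Mon) : Xadd (packK D) :=
  (rowV_add D 4).xor (((rowV_add D 5).xor (((rowV_add D 2).xor (((rowV_add D 3).xor
    ((rowV_add D 6).shl 15)).shl 15)).shl 15)).shl 15)
/-- multiply the digit at position `h` by the `c*j`-th power, for `(c, h)` in the list -/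
def shw (R : List (ℕ × ℕ)) (j v : ℕ) : ℕ :=
  R.foldr (fun r x => (mulp ((v >>> r.2) &&& 7) (r.1*j)) <<< r.2 ^^^ x) 0
theorem shw_add (R : List (ℕ × ℕ)) (j : ℕ) : Xadd (shw R j) := by
  induction R with
  | nil => exact Xadd.const0
  | cons r R ih => exact ((((mulp_add (r.1*j)).comp ((Xadd.id.shr r.2).land 7))).shl r.2).xor ih

def ChkShift (D : List Mon) (R : List (ℕ × ℕ)) : Prop :=
  ∀ k < 51, ∀ j < 7, rowR D (2^k) j = shw R j (rowV D (2^k) 0)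
def chkRep (C : ℕ) (R : List (ℕ × ℕ)) (reps : List ℕ) : Bool :=
  allN (fun k => allL (fun q => force (k*64+q) fun v =>
    (List.range 7).any fun j => reps.elem (shw R j v)) (qs C k 3)) 512
def ChkK (D : List Mon) (B0 B1 T Q2 Q3 : ℕ) : Prop :=
  ∀ k < 51, packK D (2^k) = lin B0 15 (rowV D (2^k) 0) ^^^ lin B1 15 (rowV D (2^k) 1) ^^^
    lin T 6 ((rowV D (2^k) 2 >>> 6) &&& 63) ^^^ lin Q2 6 (rowV D (2^k) 2 &&& 63) ^^^
    lin Q3 6 (rowV D (2^k) 3 &&& 63)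
def ChkQ (Q : ℕ) : Prop := ∀ q < 64, ∀ o ∈ [36, 51, 6, 21, 66], fld (lin Q 6 q) o 511 = 0
def ChkD (D : List Mon) : Prop := (∀ m ∈ D, m.s < 17) ∧ (D.map Mon.s).Nodup

theorem xor_shl (x y n : ℕ) (hx : x < 2^n) : x ^^^ (y <<< n) = x + 2^n * y := by
  rw [Nat.add_comm, Nat.two_pow_add_eq_or_of_lt hx, Nat.shiftLeft_eq, Nat.mul_comm]
  apply Nat.eq_of_testBit_eq
  intro i
  rw [Nat.testBit_xor, Nat.testBit_or, Nat.testBit_two_pow_mul]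
  by_cases hi : n ≤ i
  · rw [Nat.testBit_lt_two_pow (lt_of_lt_of_le hx (Nat.pow_le_pow_right (by norm_num) hi))]; simp
  · simp [hi]

theorem fld_eq (K o : ℕ) : fld K o 32767 = K / 2^o % 32768 := by
  change (K >>> o) &&& (2^15-1) = _
  rw [Nat.and_two_pow_sub_one_eq_mod, Nat.shiftRight_eq_div_pow]

theorem pack_fields (a b c d e K : ℕ) (ha : a < 2^15) (hb : b < 2^15) (hc : c < 2^15)
    (hd : d < 2^15) (he : e < 2^15)
    (hK : K = a ^^^ ((b ^^^ ((c ^^^ ((d ^^^ (e <<< 15)) <<< 15)) <<< 15)) <<< 15)) :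
    fld K 0 32767 = a ∧ fld K 15 32767 = b ∧ fld K 30 32767 = c ∧ fld K 45 32767 = d ∧
    fld K 60 32767 = e ∧ K >>> 75 = 0 := by
  rw [xor_shl _ _ _ ha, xor_shl _ _ _ hb, xor_shl _ _ _ hc, xor_shl _ _ _ hd] at hK
  simp only [fld_eq, Nat.shiftRight_eq_div_pow]
  norm_num at *
  omega

theorem exists_f {D : List Mon} (hn : (D.map Mon.s).Nodup) (g : Mon → F8) :
    ∃ f : ℕ → F8, ∀ m ∈ D, f m.s = g m := by
  induction D with
  | nil => exact ⟨fun _ => 0, fun m hm => by cases hm⟩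
  | cons m D ih =>
    rw [List.map_cons, List.nodup_cons] at hn
    obtain ⟨f, hf⟩ := ih hn.2
    refine ⟨Function.update f m.s (g m), ?_⟩
    intro m' hm'
    rcases List.mem_cons.mp hm' with rfl | hm'
    · simp
    · rw [Function.update_of_ne, hf m' hm']
      intro h
      exact hn.1 (h ▸ List.mem_map_of_mem hm')

section gen
variable {α : F8}

theorem G_per_i (hα : α^3 = α + 1) (D : List Mon) (c0 : F8) (f : ℕ → F8) (i j : ℕ) :
    G α D c0 f (i+7) j = G α D c0 f i j := by
  unfold G
  congr 2
  apply List.map_congr_left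
  intro m _
  congr 1
  apply gen_mod hα
  have : m.a * (i+7) + m.c * j = m.a*i + m.c*j + 7*m.a := by ring
  omega
theorem G_per_j (hα : α^3 = α + 1) (D : List Mon) (c0 : F8) (f : ℕ → F8) (i j : ℕ) :
    G α D c0 f i (j+7) = G α D c0 f i j := by
  unfold G
  congr 2
  apply List.map_congr_left
  intro m _
  congr 1
  apply gen_mod hα
  have : m.a * i + m.c * (j+7) = m.a*i + m.c*j + 7*m.c := by ring
  omega
theorem wF_per (hα : α^3 = α + 1) (D : List Mon) (c0 : F8) (f : ℕ → F8) (i : ℕ) :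
    wF α D c0 f (i+7) = wF α D c0 f i := by
  unfold wF; simp only [G_per_i hα]
theorem G_rot {D : List Mon} (c0 : F8) (f f' : ℕ → F8) (i0 j0 : ℕ)
    (h : ∀ m ∈ D, f' m.s = f m.s * α^(m.a*i0 + m.c*j0)) (i j : ℕ) :
    G α D c0 f' i j = G α D c0 f (i0+i) (j0+j) := by
  unfold G
  congr 2
  apply List.map_congr_left
  intro m hm
  rw [h m hm, mul_assoc, ← pow_add]
  congr 2; ring
theorem wF_rot (hα : α^3 = α + 1) {D : List Mon} (c0 : F8) (f f' : ℕ → F8) (i0 j0 : ℕ)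
    (h : ∀ m ∈ D, f' m.s = f m.s * α^(m.a*i0 + m.c*j0)) (i : ℕ) :
    wF α D c0 f' i = wF α D c0 f (i0+i) := by
  unfold wF
  simp only [G_rot c0 f f' i0 j0 h]
  exact sum_range7_shift (fun j => nzF (G α D c0 f (i0+i) j))
    (fun j => by simp only [G_per_j hα]) j0

theorem step (hα : α^3 = α + 1) {D : List Mon} {C B0 B1 T Q2 Q3 : ℕ} {R : List (ℕ × ℕ)}
    {reps : List ℕ} (hD : ChkD D) (hrow : ChkRow D C 15) (hR : ChkShift D R)
    (hrep : chkRep C R reps = true) (hK : ChkK D B0 B1 T Q2 Q3) (hQ2 : ChkQ Q2) (hQ3 : ChkQ Q3)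
    (hmain : stage0 C B0 B1 T Q2 Q3 reps = true) (f : ℕ → F8) :
    23 ≤ ∑ i ∈ Finset.range 7, wF α D 1 f i := by
  by_contra hcon
  obtain ⟨i0, -, hcyc⟩ := cycle (wF α D 1 f) (wF_per hα D 1 f) (by omega)
  obtain ⟨f1, hf1⟩ := exists_f hD.2 fun m => f m.s * α^(m.a*i0 + m.c*0)
  have w1 := wF_rot hα 1 f f1 i0 0 hf1
  obtain ⟨φ1, hφ1, hd1⟩ := exists_word hα f1 17
  have hφ1 : φ1 < 2^51 := by norm_num at hφ1 ⊢; exact hφ1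
  have c1 := hcyc 1 (by norm_num)
  have c2 := hcyc 2 (by norm_num)
  have c3 := hcyc 3 (by norm_num)
  have c4 := hcyc 4 (by norm_num)
  have c5 := hcyc 5 (by norm_num)
  have c6 := hcyc 6 (by norm_num)
  have c7 := hcyc 7 (by norm_num)
  simp only [← w1, Finset.sum_range_succ, Finset.sum_range_zero, Nat.zero_add] at c1 c2 c3 c4 c5 c6 c7
  -- normalise the first row
  have hv0 := rowV_lt hrow φ1 hφ1 0 (by norm_num)
  have hw0 : W C (rowV D φ1 0 >>> 6) (rowV D φ1 0 &&& 63) ≤ 3 := by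
    rw [W_eq, row_wt1 hrow φ1 hφ1 0 (by norm_num), ← wF1 hα D hD.1 f1 φ1 hd1]
    omega
  have hr := allN_true hrep (rowV D φ1 0 >>> 6) (by
    rw [Nat.shiftRight_eq_div_pow]; omega)
  have hr := allL_true hr (rowV D φ1 0 &&& 63)
    (mem_qs (Nat.lt_of_le_of_lt Nat.and_le_right (by norm_num)) hw0)
  have ev1 : (rowV D φ1 0 >>> 6) * 64 + (rowV D φ1 0 &&& 63) = rowV D φ1 0 := by
    have h63 : (63 : ℕ) = 2^6 - 1 := by norm_num
    rw [Nat.shiftRight_eq_div_pow, h63, Nat.and_two_pow_sub_one_eq_mod]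
    omega
  rw [force_eq, ev1, List.any_eq_true] at hr
  obtain ⟨j0, hj0, hmem⟩ := hr
  have hj0 : j0 < 7 := List.mem_range.mp hj0
  have hmem : shw R j0 (rowV D φ1 0) ∈ reps := by simpa using hmem
  obtain ⟨f2, hf2⟩ := exists_f hD.2 fun m => f1 m.s * α^(m.a*0 + m.c*j0)
  have w2 := wF_rot hα 1 f1 f2 0 j0 hf2
  obtain ⟨φ2, hφ2, hd2⟩ := exists_word hα f2 17
  have hφ2 : φ2 < 2^51 := by norm_num at hφ2 ⊢; exact hφ2
  have hdig : ∀ m ∈ D, dig φ2 m.s = mulp (dig φ1 m.s) (m.c*j0) := by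
    intro m hm
    apply dec_inj hα _ _ (dig_lt _ _) (mulp_lt _ _ (dig_lt _ _))
    rw [hd2 _ (hD.1 m hm), hf2 m hm, dec_mulp hα _ _ (dig_lt _ _), hd1 _ (hD.1 m hm)]
    rw [Nat.mul_zero, Nat.zero_add, mul_comm]
  have hrow0 : rowV D φ2 0 = shw R j0 (rowV D φ1 0) := by
    have a1 : rowV D φ2 0 = rowR D φ1 j0 := by
      apply xsum_congr
      intro m hm
      rw [hdig m hm]
      rfl
    rw [a1]
    exact Xadd.ext (rowR_add D j0) ((shw_add R j0).comp (rowV_add D 0)) 51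
      (fun k hk => hR k hk j0 hj0) φ1 hφ1
  have hKφ := Xadd.ext (packK_add D)
    ((((((lin_add B0 15).comp (rowV_add D 0)).xor ((lin_add B1 15).comp (rowV_add D 1))).xor
      ((lin_add T 6).comp (((rowV_add D 2).shr 6).land 63))).xor
      ((lin_add Q2 6).comp ((rowV_add D 2).land 63))).xor
      ((lin_add Q3 6).comp ((rowV_add D 3).land 63))) 51 hK φ2 hφ2
  have hlt := rowV_lt hrow φ2 hφ2
  obtain ⟨p4, p5, p2, p3, p6, pd⟩ := pack_fields _ _ _ _ _ (packK D φ2) (hlt 4 (by norm_num))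
    (hlt 5 (by norm_num)) (hlt 2 (by norm_num)) (hlt 3 (by norm_num)) (hlt 6 (by norm_num)) rfl
  simp only [Nat.zero_add] at w2
  have e0 := w2 0
  have e1 := w2 1
  have e2 := w2 2
  have e3 := w2 3
  have e4 := w2 4
  have e5 := w2 5
  have e6 := w2 6
  refine search_sound hmain (fun i => rowV D φ2 (i % 7)) (fun i => hlt _ (Nat.mod_lt _ (by norm_num)))
    (packK D φ2) hKφ p4 p5 p2 p3 p6 pd hQ2 hQ3 (by
      change rowV D φ2 0 ∈ reps
      rw [hrow0]; exact hmem) (wF α D 1 f2) ?_ ?_ ?_ ?_ ?_ ?_ ?_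
  · intro i hi
    rw [Nat.mod_eq_of_lt hi, row_wt1 hrow φ2 hφ2 i hi, wF1 hα D hD.1 f2 φ2 hd2]
  all_goals omega
end gen


/-! ### Data and certificate of search 1 -/

def C_1 : ℕ := 24315477259362926800504598483914972381466763530042021634595975253944643166775391412175387118834130518300143445644702247410816234360349670054537795616743315594141864416628138102884923382067095830311418732643239380453089388373298546574749861451444324639058395148640894118316756167381028728956757393234896467748389415274226676348988795832653245839748249427595119222839796041260879695252105794652672511331379296981567103604206309763397526479775711770367069905426419705271768089409595992595030060570398622214921090256459284026928394000732963120805605985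
def B0_1 : ℕ := 3954129098022835303958642742919998698730019825229503121216882582169825787223996565568584184849209666020362665038971777074955402451418122768093034366174740154555672409741973824706474122912416765968899915017095659439951307682680861526358158044584451596811917034135934226530504061506076928644091984607201130388832666399223410249859362667925342506673658649435821186194113640028754349301302699012057375300106196082518410085868079345067177916394619135137527255770939539385105617633038556063378654103520928923619482480856589097741911694146461979301840998153470538317827
def B1_1 : ℕ := 6590107896936078310124852978347394221447051124919216850365719662312315367897940927993703573144427833363982213861225666141986631969744153411762732772002712463796070238889956860733800484199543252082491798496788123911490319056743752077816714260837652416695347030038497752595424381229284312319748989428698357843154335866317274614645219465970714796488586392394798854115769634027681255473891972198645379308286112490127958019174033074068898808042974096646913339134554253481191972754316562716585535946753076244940253503000022855999566297451412293933644264844601990479874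
def T_1 : ℕ := 10773251474145211400390371348330376858003850030978283833379307838744025282312208878278299353849068400235458639194459577091998197746505039047105502390811585559900779138420462288975994975088347093071969864243069583552
def Q2_1 : ℕ := 210405436218707578564704564612605498261533785816822096036635114185530884213818304666166005600691841553119283441912900718001809627947876070974774184605148752594650030977879454917896930360924178487653591510868328449
def Q3_1 : ℕ := 210410572913403688302007392013784684687625508346468835930509713198065673278837964188097546383678505574521102411232516741009831891921686930646145016280419987745137739828479164222508913592061026303445358997967863811
def reps_1 : List ℕ := [577, 584, 676, 822, 914, 4105, 4334, 4474, 4572, 4609, 4820, 4966, 5106,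
  5147, 5314, 5374, 5743, 5880, 6189, 6468, 6490, 6779, 7000, 7231, 7622, 7660, 7773, 8168]
def D_1 : List Mon := [⟨0, 0, 2, 9⟩, ⟨2, 0, 5, 3⟩, ⟨3, 1, 4, 0⟩, ⟨4, 1, 3, 12⟩, ⟨5, 1, 1, 6⟩, ⟨6,
  2, 5, 3⟩, ⟨7, 2, 4, 0⟩, ⟨8, 2, 3, 12⟩, ⟨9, 3, 2, 9⟩, ⟨10, 3, 1, 6⟩, ⟨11, 3, 5, 3⟩, ⟨12, 3, 4,
  0⟩, ⟨13, 4, 4, 0⟩, ⟨14, 4, 2, 9⟩, ⟨15, 5, 5, 3⟩, ⟨16, 5, 1, 6⟩]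
def R_1 : List (ℕ × ℕ) := [(3, 12), (2, 9), (1, 6), (5, 3), (4, 0)]
theorem chkD_1 : ChkD D_1 := by unfold ChkD; decide +kernel
theorem chkRow_1 : ChkRow D_1 C_1 15 := by unfold ChkRow; decide +kernel
theorem chkShift_1 : ChkShift D_1 R_1 := by unfold ChkShift; decide +kernel
theorem chkRep_1 : chkRep C_1 R_1 reps_1 = true := by decide +kernel
theorem chkK_1 : ChkK D_1 B0_1 B1_1 T_1 Q2_1 Q3_1 := by unfold ChkK; decide +kernel
theorem chkQ2_1 : ChkQ Q2_1 := by unfold ChkQ; decide +kernel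
theorem chkQ3_1 : ChkQ Q3_1 := by unfold ChkQ; decide +kernel
theorem main_1 : stage0 C_1 B0_1 B1_1 T_1 Q2_1 Q3_1 reps_1 = true := by decide +kernel
theorem step_1 {α : F8} (hα : α^3 = α + 1) (f : ℕ → F8) :
    23 ≤ ∑ i ∈ Finset.range 7, wF α D_1 1 f i :=
  step hα chkD_1 chkRow_1 chkShift_1 chkRep_1 chkK_1 chkQ2_1 chkQ3_1 main_1 f


/-! ### Data and certificate of search 2 -/

def C_2 : ℕ := 9757429684675542283270315296070429274497414697199621589024379365657285165861460735129043623537103739281552075794919584212166401127839554324830335089653774077671271306371664572008505244737552511236756980384202118228446133507375945710944543811536631475895598938282980119741689717846075598073791832818951967122050360459482071987776356510604036465749564130194630951059895751440974501954580803627271865054266012070246364740453660919136695584951733115656225107403851454177007801191278071110122849155881385072529881368687469466886456065431429839397012785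
def B0_2 : ℕ := 3954129098022835303958642742919998698730019825229503121216882582169825787223996565568584184849209666020362665038971772893729851033227150858881067850546528258768493022487573457357130590273412909465937630679218255991321076973179339347511725581935995938190238502706869828259958363886754311154763509830915004246158185956881320733746791808490027298635462106512721316690702590952224334531791411098994406329384434085468983357260352350824761052609060917904505389417912878429819336087969063468207676827769203673600537862471508014754912988284890048153640184773855559221250
def B1_2 : ℕ := 6590107896936078310124852978347394221447051124919216850365719662312315367897940927993703573144427833363982213861225661960633479674486057894726474299322367707032711196381937302929862211772597737135391521644996257616931442127506008379569975073426400593805568824984070339819572014125114988786671402828491520479829582023719700441877937964349180048617893163986852579404155573134843443467836202388969098423229645346954348782600327608641174504306934118135045651301175090652158928721030429051936345123464784455489414870292201022318481064578295247147550022725244708487169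
def T_2 : ℕ := 10773169284521673169010500475555571401663769458790073190542628983400177300013515026426746480587293186135464202737835837993623698734031203456400212949983738099544024372737297095534105578859873729956471245310397513920
def Q2_2 : ℕ := 84162174581541830361687268553486390151555393401572642134434459757407357566765857202218981551240883866056591784961336594607418808384191246713945086520588096471851307900154518210908480934981717013555266634161291266
def Q3_2 : ℕ := 1034226885555686473051653901818164236288210154466821203204047924002110735181413613224369627642167127834334023803395877906602502826226443430299291738289215882405570238078402216779907682005776434415059631517642063577091
def reps_2 : List ℕ := [73, 577, 692, 790, 930, 4333, 4479, 4571, 4616, 4672, 5139, 5349, 5519,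
  5573, 5840, 6121, 6181, 6283, 6343, 6519, 6905, 7008, 7223, 7437, 7491, 7635, 8025, 8176]
def D_2 : List Mon := [⟨0, 5, 3, 0⟩, ⟨2, 5, 4, 6⟩, ⟨3, 6, 3, 0⟩, ⟨4, 6, 5, 3⟩, ⟨5, 6, 2, 9⟩, ⟨6,
  0, 5, 3⟩, ⟨8, 0, 2, 9⟩, ⟨9, 1, 1, 12⟩, ⟨10, 1, 3, 0⟩, ⟨11, 1, 2, 9⟩, ⟨12, 1, 4, 6⟩, ⟨13, 2, 1,
  12⟩, ⟨14, 2, 5, 3⟩, ⟨15, 3, 3, 0⟩, ⟨16, 3, 4, 6⟩]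
def R_2 : List (ℕ × ℕ) := [(1, 12), (2, 9), (4, 6), (5, 3), (3, 0)]
theorem chkD_2 : ChkD D_2 := by unfold ChkD; decide +kernel
theorem chkRow_2 : ChkRow D_2 C_2 15 := by unfold ChkRow; decide +kernel
theorem chkShift_2 : ChkShift D_2 R_2 := by unfold ChkShift; decide +kernel
theorem chkRep_2 : chkRep C_2 R_2 reps_2 = true := by decide +kernel
theorem chkK_2 : ChkK D_2 B0_2 B1_2 T_2 Q2_2 Q3_2 := by unfold ChkK; decide +kernel
theorem chkQ2_2 : ChkQ Q2_2 := by unfold ChkQ; decide +kernel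
theorem chkQ3_2 : ChkQ Q3_2 := by unfold ChkQ; decide +kernel
theorem main_2 : stage0 C_2 B0_2 B1_2 T_2 Q2_2 Q3_2 reps_2 = true := by decide +kernel
theorem step_2 {α : F8} (hα : α^3 = α + 1) (f : ℕ → F8) :
    23 ≤ ∑ i ∈ Finset.range 7, wF α D_2 1 f i :=
  step hα chkD_2 chkRow_2 chkShift_2 chkRep_2 chkK_2 chkQ2_2 chkQ3_2 main_2 f


/-! ### Data and certificate of search 3 -/

def C_3 : ℕ := 24315477259362926800504598483914972381466763530042021634595975253944643166775391412175387118834130518300143445644702924659414135669914263832758121595923187876162719474210664681256992494979718994469315824680850624046184817804129102987066211216672558565980914701201385386573050687871596542922836134727628445164997944789976607344250044176435623555599089726490658380452283643333861406273329456105415578484966053496277657174515912792274518463629752726143576645374292453670474437594766461276221198031768863464161332408405971711592024472321525474236183585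
def B0_3 : ℕ := 64581681751337384547139748127474997221056755823217352914286783863015081912733283402440413418336407025932253710854115079342095179170651998761428936942110907549240551692144786482128178611510217156776381961006565326487328570858566972992465919575865832139311641639054195840135968004667460615313784995562331717291026192966629344047087901087988578191130989296879267658646693151768585132192940273404401939219051639780143323346530749456248495241122655562996363124430983428337097926376887683038286691779271475640006393815246036118862667219954498867179572641199753202401286
def B1_3 : ℕ := 27677817639893925118585087304005008501599220588938058731055426793236713792813582349319319451837922368597880660425830557170506166461820685015464557225228383131877144582205701766642932781380629111584546855456258714881614533182296149148607004976133641601639315303781507317976367297776472662151417151265063135015459802331245145221138264014155617276207072947573370371134143082255500926705849822984620615956168672822389721894783805664424678440880884908275988915210057006622153017107174456937106987522245981853093678389091367249245713402036521235201528765972915821838342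
def T_3 : ℕ := 5386461362841909201328848764963317041222379907571581272191023493804437870997334173999732106890184439980344858022027774831115881769155003027431420492289963514884403679921154079907094175190447231990573803940199006400
def Q2_3 : ℕ := 9652686028039121251937739559250227455295733498569197592216924934740328391111611987754502952151931785916183477392939864424720066553859000851709967528798639829444228116651111901591111400873612391159509773543226766131205
def Q3_3 : ℕ := 6894691577275972755515202276424317389078986502071522485131629267794816620256355884706822345980570988304941876452728833680680946385842131875680210282094183115690251621377640062479118428344608280389409194831678837719044
def reps_3 : List ℕ := [73, 577, 764, 862, 1002, 4347, 4445, 4591, 4616, 4672, 5181, 5239, 5251,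
  5405, 5784, 6009, 6175, 6227, 6405, 6575, 6952, 7129, 7211, 7269, 7355, 7559, 7913, 8120]
def D_3 : List Mon := [⟨0, 0, 1, 0⟩, ⟨3, 1, 4, 9⟩, ⟨4, 1, 2, 6⟩, ⟨5, 1, 5, 3⟩, ⟨6, 2, 5, 3⟩, ⟨8,
  2, 1, 0⟩, ⟨9, 3, 5, 3⟩, ⟨10, 3, 3, 12⟩, ⟨11, 3, 4, 9⟩, ⟨12, 3, 2, 6⟩, ⟨13, 4, 1, 0⟩, ⟨14, 4, 4,
  9⟩, ⟨15, 5, 2, 6⟩, ⟨16, 5, 1, 0⟩]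
def R_3 : List (ℕ × ℕ) := [(3, 12), (4, 9), (2, 6), (5, 3), (1, 0)]
theorem chkD_3 : ChkD D_3 := by unfold ChkD; decide +kernel
theorem chkRow_3 : ChkRow D_3 C_3 15 := by unfold ChkRow; decide +kernel
theorem chkShift_3 : ChkShift D_3 R_3 := by unfold ChkShift; decide +kernel
theorem chkRep_3 : chkRep C_3 R_3 reps_3 = true := by decide +kernel
theorem chkK_3 : ChkK D_3 B0_3 B1_3 T_3 Q2_3 Q3_3 := by unfold ChkK; decide +kernel
theorem chkQ2_3 : ChkQ Q2_3 := by unfold ChkQ; decide +kernel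
theorem chkQ3_3 : ChkQ Q3_3 := by unfold ChkQ; decide +kernel
theorem main_3 : stage0 C_3 B0_3 B1_3 T_3 Q2_3 Q3_3 reps_3 = true := by decide +kernel
theorem step_3 {α : F8} (hα : α^3 = α + 1) (f : ℕ → F8) :
    23 ≤ ∑ i ∈ Finset.range 7, wF α D_3 1 f i :=
  step hα chkD_3 chkRow_3 chkShift_3 chkRep_3 chkK_3 chkQ2_3 chkQ3_3 main_3 f


/-! ### Data and certificate of search 4 -/

def C_4 : ℕ := 9757429684675542283270315296070429274497414697199621589024379365657285165861460735129043623537103739281552075794920163113221383435531761142553648634762297479187896585058449491381203956818130737766065452805324652537309484531548607901695333500886710286994125756313576411978633430330138396409580293433419441788182203448473361903929531361894723500828960460364274904217947298569517835136606737886430838153094188164377930954004329931823362489935304712140952944755846699733586245189259860250118215682683640952905984833446940177731064490791999544948453985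
def B0_4 : ℕ := 440208660941405369391567910751361019114761927876141080988556748728996292400145163174855892356108382386843824279706631947935438381031810093600897099847141784041063419718189813978848412355124821892445097626922291979584076917981980584899742842714856032725642550045646419041091604635084051318514634836384928117643391562832017480271655869424108251451928943341223157223405686335249452469187054490056035452124919443206540657015998632043473050515202620391172553655685806326881739265914173559348681485951639666203951213227357979325995249642741967127135722380784890038943749
def B1_4 : ℕ := 477112203278092802429793354366965898086261960078731883216961706783100399452569047154086540818776943099855064969573878845425131424801038431744488442019182579220664611468640084761021881182389541891245276623440667485593778977704150842159206189808549883972505261533771414799441812086198541465629682346158704479917858496066190637891371917257653598998897291858855053447899699639826746007409037218702289595622788173793079934926712425845493556460014627553782052139222307020621727544964907913221456912014043750243558874800222829486401564305191672157114742658621892704043012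
def T_4 : ℕ := 8080061892551984899044549594887415024171333518151271190140630580707685983243767570332238045639197400594650854974457186789700900390487609483831366339164982332533896774843383985212759652546325148340172777788790538624
def Q2_4 : ℕ := 77219384169951253269592609438345929392177602386779586125337710096544979279617944929804638219997341331008765585106703734698560008930427490835509520363194179729998646881225051101007165735987237168436402038722484752121857
def Q3_4 : ℕ := 44125470596476024186486267761088150907621109034034116291554276268585912901693637328341153359858592830364963645032285891545940973068490217057789861186791038373861141338551567188992943076306650552640114060945251685826565
def reps_4 : List ℕ := [73, 521, 678, 818, 916, 4161, 4271, 4411, 4509, 4672, 4798, 4890, 5036,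
  5272, 5315, 5535, 5663, 6093, 6315, 6440, 6469, 6699, 6863, 7485, 7608, 7623, 7741, 8011]
def D_4 : List Mon := [⟨0, 4, 4, 0⟩, ⟨3, 5, 5, 9⟩, ⟨4, 5, 2, 6⟩, ⟨5, 5, 3, 3⟩, ⟨6, 6, 3, 3⟩, ⟨8,
  6, 4, 0⟩, ⟨9, 0, 3, 3⟩, ⟨11, 0, 5, 9⟩, ⟨12, 0, 2, 6⟩, ⟨13, 1, 4, 0⟩, ⟨14, 1, 5, 9⟩, ⟨15, 2, 2,
  6⟩, ⟨16, 2, 4, 0⟩]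
def R_4 : List (ℕ × ℕ) := [(1, 12), (5, 9), (2, 6), (3, 3), (4, 0)]
theorem chkD_4 : ChkD D_4 := by unfold ChkD; decide +kernel
theorem chkRow_4 : ChkRow D_4 C_4 15 := by unfold ChkRow; decide +kernel
theorem chkShift_4 : ChkShift D_4 R_4 := by unfold ChkShift; decide +kernel
theorem chkRep_4 : chkRep C_4 R_4 reps_4 = true := by decide +kernel
theorem chkK_4 : ChkK D_4 B0_4 B1_4 T_4 Q2_4 Q3_4 := by unfold ChkK; decide +kernel
theorem chkQ2_4 : ChkQ Q2_4 := by unfold ChkQ; decide +kernel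
theorem chkQ3_4 : ChkQ Q3_4 := by unfold ChkQ; decide +kernel
theorem main_4 : stage0 C_4 B0_4 B1_4 T_4 Q2_4 Q3_4 reps_4 = true := by decide +kernel
theorem step_4 {α : F8} (hα : α^3 = α + 1) (f : ℕ → F8) :
    23 ≤ ∑ i ∈ Finset.range 7, wF α D_4 1 f i :=
  step hα chkD_4 chkRow_4 chkShift_4 chkRep_4 chkK_4 chkQ2_4 chkQ3_4 main_4 f



/-! ### The final step: thirteen monomials in four classes -/

def wt5 (C v : ℕ) : ℕ := wt (lin C 12 v)
def wat (C K o : ℕ) : ℕ := forceN (fld K o 4095) fun v => Nat.add (wt5 C v) 0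
def chk4 (C : ℕ) : Bool := allN (fun v => ite2 (Nat.beq v 0) true (Nat.ble 4 (wt5 C v))) 4096
def tot5 (C K : ℕ) : ℕ :=
  Nat.add (Nat.add (Nat.add (Nat.add (wat C K 0) (wat C K 12)) (wat C K 24)) (wat C K 36))
    (wat C K 48)
def chk5 (C E1 E2 : ℕ) : Bool :=
  allN (fun u => force (lin E1 12 u) fun K1 => allN (fun x =>
    force (Nat.xor K1 (lin E2 3 x)) fun K =>
    ite2 (Nat.beq K 0) true (Nat.ble 23 (tot5 C K))) 8) 4096
def pack5 (r1 r2 r3 r4 r5 : ℕ) : ℕ :=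
  r1 ^^^ ((r2 ^^^ ((r3 ^^^ ((r4 ^^^ (r5 <<< 12)) <<< 12)) <<< 12)) <<< 12)
def ChkK5 (D : List Mon) (Z0 Z1 E1 E2 d e e' i1 i2 i3 i4 i5 : ℕ) : Prop :=
  ∀ k < 51, pack5 (rowV D (2^k) i1) (rowV D (2^k) i2) (rowV D (2^k) i3) (rowV D (2^k) i4)
      (rowV D (2^k) i5) =
    lin Z0 12 (rowV D (2^k) 0) ^^^ lin Z1 12 (rowV D (2^k) d) ^^^ lin E1 12 (rowV D (2^k) e) ^^^
    lin E2 3 (rowV D (2^k) e' &&& 7)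

theorem fld_eq12 (K o : ℕ) : fld K o 4095 = K / 2^o % 4096 := by
  change (K >>> o) &&& (2^12-1) = _
  rw [Nat.and_two_pow_sub_one_eq_mod, Nat.shiftRight_eq_div_pow]
theorem pack5_fields (a b c d e K : ℕ) (ha : a < 2^12) (hb : b < 2^12) (hc : c < 2^12)
    (hd : d < 2^12) (he : e < 2^12) (hK : K = pack5 a b c d e) :
    fld K 0 4095 = a ∧ fld K 12 4095 = b ∧ fld K 24 4095 = c ∧ fld K 36 4095 = d ∧
    fld K 48 4095 = e := by
  unfold pack5 at hK
  rw [xor_shl _ _ _ ha, xor_shl _ _ _ hb, xor_shl _ _ _ hc, xor_shl _ _ _ hd] at hK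
  simp only [fld_eq12]
  norm_num at *
  omega
theorem wat_eq (C K o : ℕ) : wat C K o = wt (lin C 12 (fld K o 4095)) := by
  unfold wat; rw [forceN_eq]; rfl
theorem wt_zero : wt 0 = 0 := by decide

theorem sound5 {D : List Mon} {C Z0 Z1 E1 E2 d e e' i1 i2 i3 i4 i5 : ℕ}
    (hi : d < 7 ∧ e < 7 ∧ e' < 7 ∧ i1 < 7 ∧ i2 < 7 ∧ i3 < 7 ∧ i4 < 7 ∧ i5 < 7)
    (hrow : ChkRow D C 12) (hK : ChkK5 D Z0 Z1 E1 E2 d e e' i1 i2 i3 i4 i5)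
    (h5 : chk5 C E1 E2 = true) (φ : ℕ) (hφ : φ < 2^51) (h0 : rowV D φ 0 = 0)
    (hd : rowV D φ d = 0) (w : ℕ → ℕ) (hw : ∀ i < 7, w i = wt (lin C 12 (rowV D φ i))) :
    w i1 + w i2 + w i3 + w i4 + w i5 = 0 ∨ 23 ≤ w i1 + w i2 + w i3 + w i4 + w i5 := by
  obtain ⟨j0, j1, j2, j3, j4, j5, j6, j7⟩ := hi
  have hKφ := Xadd.ext (F := fun φ => pack5 (rowV D φ i1) (rowV D φ i2) (rowV D φ i3) (rowV D φ i4)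
      (rowV D φ i5)) ((rowV_add D i1).xor (((rowV_add D i2).xor (((rowV_add D i3).xor
    (((rowV_add D i4).xor ((rowV_add D i5).shl 12)).shl 12)).shl 12)).shl 12))
    (((((lin_add Z0 12).comp (rowV_add D 0)).xor ((lin_add Z1 12).comp (rowV_add D d))).xor
      ((lin_add E1 12).comp (rowV_add D e))).xor
      ((lin_add E2 3).comp ((rowV_add D e').land 7))) 51 hK φ hφ
  simp only [h0, hd, (lin_add Z0 12).zero, (lin_add Z1 12).zero, Nat.zero_xor] at hKφ
  have hlt := rowV_lt hrow φ hφ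
  obtain ⟨p1, p2, p3, p4, p5⟩ := pack5_fields _ _ _ _ _ _ (hlt i1 j3) (hlt i2 j4) (hlt i3 j5)
    (hlt i4 j6) (hlt i5 j7) rfl
  have h := allN_true h5 (rowV D φ e) (hlt e j1)
  rw [force_eq] at h
  have h := allN_true h (rowV D φ e' &&& 7) (Nat.lt_of_le_of_lt Nat.and_le_right (by norm_num))
  rw [force_eq] at h
  have ex : Nat.xor (lin E1 12 (rowV D φ e)) (lin E2 3 (rowV D φ e' &&& 7)) =
    pack5 (rowV D φ i1) (rowV D φ i2) (rowV D φ i3) (rowV D φ i4) (rowV D φ i5) := hKφ.symm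
  rw [ex] at h
  generalize pack5 (rowV D φ i1) (rowV D φ i2) (rowV D φ i3) (rowV D φ i4) (rowV D φ i5) = K
    at h p1 p2 p3 p4 p5
  rw [ite2_eq] at h
  rw [hw i1 j3, hw i2 j4, hw i3 j5, hw i4 j6, hw i5 j7]
  by_cases hz : Nat.beq K 0 = true
  · left
    have : K = 0 := Nat.eq_of_beq_eq_true hz
    subst this
    rw [← p1, ← p2, ← p3, ← p4, ← p5]
    simp only [fld_eq12, Nat.zero_div, Nat.zero_mod, (lin_add C 12).zero, wt_zero]
  · right
    rw [if_neg hz] at h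
    have h : 23 ≤ tot5 C K := Nat.le_of_ble_eq_true h
    unfold tot5 at h
    rw [wat_eq, wat_eq, wat_eq, wat_eq, wat_eq, p1, p2, p3, p4, p5] at h
    exact h

theorem chkRow_5 : ChkRow D_4 C_4 12 := by unfold ChkRow; decide +kernel
theorem chk4_5 : chk4 C_4 = true := by decide +kernel
def Z0_51 : ℕ := 1744725810255344372078411345138524551029658776707939609344953601756473955449203579192512976758894477579127489434649009125954353338683932322397053551007644117573027771897696093959273718190654620589927783123958501797565528897013165063387383752608097956559794189923495272939781617498163586797158302446607653416831145993945624521735432535273804791675394782781018448109084264232663358103801101002538258541134433743290410728666121446698745069568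
def Z1_51 : ℕ := 7146396918805890548033172869687396561017482349395720639876929952794517321519937860372533152804431780164106196724282541000027662002990086880009844996314690686901390897904070641466840959572970054225781644314461334581156566969026261611484544672415435976938405984025484888864704859772583221011586844040466941108047400904232179481772422339334159944977457585483828106427047852888468586726214791332076121216013944529026520124752989662802508387450880
def E1_51 : ℕ := 3062421362481223020247031936141711528324704671416132166830302982497643789773374621015793937874224766530923624283448342016137519319216894332105854946541185968263997962490083154959216150046572735334741527285585707223700908154201725985660199406315840056182922455285418355180955258552433933830356785297977012422067177640120613724791389546904920861703065452866611243958314130649609625064193382115663772133670327569395710013014944929924797763158017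
def E2_51 : ℕ := 97817516610203037113780154008245498063481962934222013020660957613623725044780894891347546112
theorem chkK_51 : ChkK5 D_4 Z0_51 Z1_51 E1_51 E2_51 1 2 3 2 3 4 5 6 := by
  unfold ChkK5; decide +kernel
theorem chk5_51 : chk5 C_4 E1_51 E2_51 = true := by decide +kernel
def Z0_52 : ℕ := 1744725810255344372078411345138524551029658776707939609344953601756473955449203579192512976758894477579127489434649009125954353338683932322397053551007644117573027771897696093959273718190654620589927783123958501797565528897013165063387383752608097956559794189923495272939781617498163586797158302446607653416831145993945624521735432535273804791675394782781018448109084264232663358103801101002538258541134433743290410728666121446698745069568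
def Z1_52 : ℕ := 3062421362481208513706787136492416164357319399156881484052692851679711799019086062146218204006514134150105091465293666694941536734413663016168501369595327254144363705881724373477927652699458756352432134859807610646371980090773462148302842086654411296119551808052077063563931565128968520371893223745360164472765951007825560897369410641518267080376190837394210478579018755906350806539410413109893502800484114779996406385924780617629321146662912
def E1_52 : ℕ := 7146396918805905054573417669336691924984867621654971322654540083612449312274226419242108886672142412544924729542437216321223644587793318195947198573260549401021025154512429422948129456920084033208091036740239431158485495032454525448841901992076864737001776631258826180481728553196048634470050405593083789057348627536527232309194401244720813726304332200956228871806343227631727405250997760337846390549200157318425823751843153975097985003945985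
def E2_52 : ℕ := 97817516610203037113780154008245498063481962934222013020660957613623725044780894891347546112
theorem chkK_52 : ChkK5 D_4 Z0_52 Z1_52 E1_52 E2_52 2 1 3 1 3 4 5 6 := by
  unfold ChkK5; decide +kernel
theorem chk5_52 : chk5 C_4 E1_52 E2_52 = true := by decide +kernel
def Z0_53 : ℕ := 1022551562709593929838990519723803935671090186541619679852571308338998693983749809429620441528034606737086148645348841619848445720630132451406058200362620142316551460306311321655912139025026830288435784454060560664013960066155171275378939588470083168148100101719760410732157432795656488462450548225877770212147011109102221321648281271306994218682157174104816905687401284250567198263513017248591572723160929878383504139305530943249036584419328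
def Z1_53 : ℕ := 2041614403862480983970228870072305628204264919266621444894213025525834888697132752642234386447657954858578345007817283050466625068630592933168525532478182228181042179341151253167937291826225507068193881069723840004841997377303305263459066717755220288878890484858653710752833896792380368382218476264032119930061643109130970763853465520286905829510619003081812426684170134091634829986028264411843645376950865353392218685997222848072798229757952
def E1_53 : ℕ := 7146396918805905054573417669336691924984867621654971322654540083612449312274226419242108886672142412544924729542437229274178187629969467237780462507353433092155530533958497811501283726469540822756369541588447994183193510744789229482517890912289632912931893447066904920767065806903392912791155654684680206918028979302331194419074276407706625848664322695086057991863886796465454198643557868957819121866188206222861179315165779077876040299708417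
def E2_53 : ℕ := 130402138945110042359258940745749013153709984362247681762934789734341092694054435928703766528
theorem chkK_53 : ChkK5 D_4 Z0_53 Z1_53 E1_53 E2_53 3 1 2 1 2 4 5 6 := by
  unfold ChkK5; decide +kernel
theorem chk5_53 : chk5 C_4 E1_53 E2_53 = true := by decide +kernel

theorem step_5 {α : F8} (hα : α^3 = α + 1) (f : ℕ → F8)
    (h1 : 1 ≤ ∑ i ∈ Finset.range 7, wF α D_4 0 f i) :
    23 ≤ ∑ i ∈ Finset.range 7, wF α D_4 0 f i := by
  by_contra hcon
  -- zero rows have zero words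
  have rows : ∀ f : ℕ → F8, ∃ φ < 2^51, ∀ i < 7,
      wF α D_4 0 f i = wt (lin C_4 12 (rowV D_4 φ i)) ∧
      (rowV D_4 φ i = 0 ∨ 4 ≤ wF α D_4 0 f i) := by
    intro f
    obtain ⟨φ, hφ, hd⟩ := exists_word hα f 17
    have hφ : φ < 2^51 := by norm_num at hφ ⊢; exact hφ
    refine ⟨φ, hφ, fun i hi => ?_⟩
    have e : wF α D_4 0 f i = wt (lin C_4 12 (rowV D_4 φ i)) := by
      rw [row_wt0 chkRow_5 φ hφ i hi, wF0 hα D_4 chkD_4.1 f φ hd]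
    refine ⟨e, ?_⟩
    have h := allN_true chk4_5 _ (rowV_lt chkRow_5 φ hφ i hi)
    rw [ite2_eq] at h
    by_cases hz : Nat.beq (rowV D_4 φ i) 0 = true
    · left; exact Nat.eq_of_beq_eq_true hz
    · right
      rw [if_neg hz] at h
      rw [e]; exact Nat.le_of_ble_eq_true h
  have noz : ∀ i0 d, 1 ≤ d → d ≤ 3 → wF α D_4 0 f i0 = 0 → wF α D_4 0 f (i0+d) = 0 → False := by
    intro i0 d hd1 hd3 z0 zd
    obtain ⟨f1, hf1⟩ := exists_f chkD_4.2 fun m => f m.s * α^(m.a*i0 + m.c*0)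
    have w1 := wF_rot hα 0 f f1 i0 0 hf1
    have htot := sum_range7_shift (wF α D_4 0 f) (wF_per hα D_4 0 f) i0
    simp only [← w1] at htot
    rw [← htot] at h1 hcon
    have z0' : wF α D_4 0 f1 0 = 0 := by rw [w1]; exact z0
    have zd' : wF α D_4 0 f1 d = 0 := by rw [w1]; exact zd
    obtain ⟨φ, hφ, hr⟩ := rows f1
    have v0 : rowV D_4 φ 0 = 0 := by
      rcases (hr 0 (by norm_num)).2 with h | h
      · exact h
      · omega
    have vd : rowV D_4 φ d = 0 := by
      rcases (hr d (by omega)).2 with h | h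
      · exact h
      · omega
    have hw := fun i hi => (hr i hi).1
    simp only [Finset.sum_range_succ, Finset.sum_range_zero] at h1 hcon
    interval_cases d
    · have := sound5 (by norm_num) chkRow_5 chkK_51 chk5_51 φ hφ v0 vd _ hw
      omega
    · have := sound5 (by norm_num) chkRow_5 chkK_52 chk5_52 φ hφ v0 vd _ hw
      omega
    · have := sound5 (by norm_num) chkRow_5 chkK_53 chk5_53 φ hφ v0 vd _ hw
      omega
  obtain ⟨φ, hφ, hr⟩ := rows f
  have dich : ∀ i < 7, wF α D_4 0 f i = 0 ∨ 4 ≤ wF α D_4 0 f i := by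
    intro i hi
    rcases (hr i hi).2 with h | h
    · left; rw [(hr i hi).1, h, (lin_add C_4 12).zero, wt_zero]
    · right; exact h
  have pair : ∀ i j, i < j → j < 7 → 4 ≤ wF α D_4 0 f i + wF α D_4 0 f j := by
    intro i j hij hj
    rcases dich i (by omega) with hi | hi
    · rcases dich j hj with hj' | hj'
      · exfalso
        by_cases hd : j - i ≤ 3
        · refine noz i (j - i) (by omega) hd hi ?_
          have : i + (j - i) = j := by omega
          rw [this]; exact hj'
        · refine noz j (7 - (j - i)) (by omega) (by omega) hj' ?_
          have : j + (7 - (j - i)) = i + 7 := by omega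
          rw [this, wF_per hα]; exact hi
      · omega
    · omega
  simp only [Finset.sum_range_succ, Finset.sum_range_zero] at hcon
  have p01 := pair 0 1 (by norm_num) (by norm_num)
  have p23 := pair 2 3 (by norm_num) (by norm_num)
  have p45 := pair 4 5 (by norm_num) (by norm_num)
  have others : ∀ k < 7, wF α D_4 0 f k = 0 → ∀ j < 7, j ≠ k → 4 ≤ wF α D_4 0 f j := by
    intro k hk hz j hj hne
    rcases Nat.lt_or_gt_of_ne hne with h | h
    · have := pair j k h hk; omega
    · have := pair k j h hj; omega
  by_cases hall : ∀ k < 7, 4 ≤ wF α D_4 0 f k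
  · have a0 := hall 0 (by norm_num)
    have a1 := hall 1 (by norm_num)
    have a2 := hall 2 (by norm_num)
    have a3 := hall 3 (by norm_num)
    have a4 := hall 4 (by norm_num)
    have a5 := hall 5 (by norm_num)
    omega
  · push Not at hall
    obtain ⟨k, hk, hlt⟩ := hall
    have hz : wF α D_4 0 f k = 0 := by
      rcases dich k hk with h | h <;> omega
    have o := others k hk hz
    have a0 : k = 0 ∨ 4 ≤ wF α D_4 0 f 0 := by
      by_cases h : k = 0
      · exact Or.inl h
      · exact Or.inr (o 0 (by norm_num) (Ne.symm h))
    have a : ∀ j < 7, k = j ∨ 4 ≤ wF α D_4 0 f j := by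
      intro j hj
      by_cases h : k = j
      · exact Or.inl h
      · exact Or.inr (o j hj (Ne.symm h))
    have a1 := a 1 (by norm_num)
    have a2 := a 2 (by norm_num)
    have a3 := a 3 (by norm_num)
    have a4 := a 4 (by norm_num)
    have a5 := a 5 (by norm_num)
    have a6 := a 6 (by norm_num)
    omega



/-! ### Codewords -/

def SA : List (ℕ × ℕ) := [(0,1),(0,3),(0,5),(1,1),(1,2),(1,4),(2,2),(2,3),(2,4),(3,0),(3,1),
  (3,4),(3,5),(4,0),(4,2),(5,1),(5,5)]
def sx (s : ℕ) : ℕ × ℕ := SA.getD s (0,0)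
def cw (α : F8) (f : ℕ → F8) (X Y : ℕ) : F8 :=
  ∑ s ∈ Finset.range 17, f s * α^((sx s).1 * X + (sx s).2 * Y)
def N (α : F8) (f : ℕ → F8) : ℕ :=
  ∑ X ∈ Finset.range 7, ∑ Y ∈ Finset.range 7, nzF (cw α f X Y)

theorem S_eq : S = Set.range fun s : Fin 17 => sx s := by
  ext x
  constructor
  · intro hx
    simp only [S, Set.mem_insert_iff, Set.mem_singleton_iff] at hx
    rcases hx with rfl | rfl | rfl | rfl | rfl | rfl | rfl | rfl | rfl | rfl | rfl | rfl | rfl |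
      rfl | rfl | rfl | rfl
    exacts [⟨0, rfl⟩, ⟨1, rfl⟩, ⟨2, rfl⟩, ⟨3, rfl⟩, ⟨4, rfl⟩, ⟨5, rfl⟩, ⟨6, rfl⟩, ⟨7, rfl⟩, ⟨8, rfl⟩,
      ⟨9, rfl⟩, ⟨10, rfl⟩, ⟨11, rfl⟩, ⟨12, rfl⟩, ⟨13, rfl⟩, ⟨14, rfl⟩, ⟨15, rfl⟩, ⟨16, rfl⟩]
  · rintro ⟨s, rfl⟩
    fin_cases s <;> simp [S, sx, SA]

/-- compatibility of a monomial list with a change of coordinates -/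
def ChkT (D : List Mon) (s0 q0 q1 r0 r1 : ℕ) : Prop :=
  (∀ m ∈ D, ((sx m.s).1*q0 + (sx m.s).2*q1) % 7 = ((sx s0).1*q0 + (sx s0).2*q1 + m.a) % 7 ∧
    ((sx m.s).1*r0 + (sx m.s).2*r1) % 7 = ((sx s0).1*r0 + (sx s0).2*r1 + m.c) % 7) ∧
  (s0 :: D.map Mon.s).Nodup ∧ (∀ s ∈ s0 :: D.map Mon.s, s < 17)
def pt (q0 q1 r0 r1 : ℕ) (p : ℕ × ℕ) : ℕ × ℕ := ((q0*p.1 + r0*p.2) % 7, (q1*p.1 + r1*p.2) % 7)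
def ChkP (q0 q1 r0 r1 : ℕ) : Prop :=
  (Finset.range 7 ×ˢ Finset.range 7).image (pt q0 q1 r0 r1) = Finset.range 7 ×ˢ Finset.range 7

section gen
variable {α : F8}

theorem N_eq {q0 q1 r0 r1 : ℕ} (hP : ChkP q0 q1 r0 r1) (f : ℕ → F8) :
    N α f = ∑ i ∈ Finset.range 7, ∑ j ∈ Finset.range 7,
      nzF (cw α f ((q0*i + r0*j) % 7) ((q1*i + r1*j) % 7)) := by
  unfold N
  rw [← Finset.sum_product', ← Finset.sum_product']
  have inj : Set.InjOn (pt q0 q1 r0 r1) (Finset.range 7 ×ˢ Finset.range 7 : Finset (ℕ × ℕ)) := by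
    apply Finset.injOn_of_card_image_eq
    rw [hP]
  have h := Finset.sum_image (f := fun p : ℕ × ℕ => nzF (cw α f p.1 p.2)) inj
  rw [hP] at h
  exact h

theorem cw_eq (hα : α^3 = α + 1) {D : List Mon} {s0 q0 q1 r0 r1 : ℕ} (hT : ChkT D s0 q0 q1 r0 r1)
    (f : ℕ → F8) (hf : ∀ s < 17, s ∉ s0 :: D.map Mon.s → f s = 0) (i j : ℕ) :
    cw α f ((q0*i + r0*j) % 7) ((q1*i + r1*j) % 7) =
      α^(((sx s0).1*q0 + (sx s0).2*q1)*i + ((sx s0).1*r0 + (sx s0).2*r1)*j) *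
        G α D (f s0) f i j := by
  obtain ⟨hm, hn, hlt⟩ := hT
  have e1 : ∀ s, α^((sx s).1 * ((q0*i + r0*j) % 7) + (sx s).2 * ((q1*i + r1*j) % 7)) =
      α^(((sx s).1*q0 + (sx s).2*q1)*i + ((sx s).1*r0 + (sx s).2*r1)*j) := by
    intro s
    apply gen_mod hα
    have e : ((sx s).1*q0 + (sx s).2*q1)*i + ((sx s).1*r0 + (sx s).2*r1)*j =
      (sx s).1 * (q0*i + r0*j) + (sx s).2 * (q1*i + r1*j) := by ring
    rw [e]
    exact Nat.ModEq.add (Nat.ModEq.mul_left _ (Nat.mod_modEq _ _))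
      (Nat.ModEq.mul_left _ (Nat.mod_modEq _ _))
  unfold cw
  simp only [e1]
  set F : ℕ → F8 := fun s =>
    f s * α^(((sx s).1*q0 + (sx s).2*q1)*i + ((sx s).1*r0 + (sx s).2*r1)*j) with hF
  have h1 : ∑ s ∈ Finset.range 17, F s = ((s0 :: D.map Mon.s).map F).sum := by
    rw [← List.sum_toFinset F hn]
    symm
    apply Finset.sum_subset
    · intro s hs
      exact Finset.mem_range.mpr (hlt s (List.mem_toFinset.mp hs))
    · intro s hs hns
      change f s * _ = 0
      rw [hf s (Finset.mem_range.mp hs) (fun h => hns (List.mem_toFinset.mpr h)), zero_mul]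
  rw [h1]
  unfold G
  rw [List.map_cons, List.sum_cons, mul_add, ← List.sum_map_mul_left, List.map_map]
  congr 1
  · simp only [hF]; ring
  · congr 1
    apply List.map_congr_left
    intro m hmem
    obtain ⟨ha, hc⟩ := hm m hmem
    have e2 : α^(((sx m.s).1*q0 + (sx m.s).2*q1)*i + ((sx m.s).1*r0 + (sx m.s).2*r1)*j) =
        α^(((sx s0).1*q0 + (sx s0).2*q1)*i + ((sx s0).1*r0 + (sx s0).2*r1)*j) *
          α^(m.a*i + m.c*j) := by
      rw [← pow_add]
      apply gen_mod hα
      have e : ((sx s0).1*q0 + (sx s0).2*q1)*i + ((sx s0).1*r0 + (sx s0).2*r1)*j +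
          (m.a*i + m.c*j) = ((sx s0).1*q0 + (sx s0).2*q1 + m.a)*i +
            ((sx s0).1*r0 + (sx s0).2*r1 + m.c)*j := by ring
      rw [e]
      exact Nat.ModEq.add (Nat.ModEq.mul_right _ ha) (Nat.ModEq.mul_right _ hc)
    simp only [Function.comp, hF]
    rw [e2]; ring

theorem N_wF (hα : α^3 = α + 1) {D : List Mon} {s0 q0 q1 r0 r1 : ℕ} (hT : ChkT D s0 q0 q1 r0 r1)
    (hP : ChkP q0 q1 r0 r1) (f : ℕ → F8) (hf : ∀ s < 17, s ∉ s0 :: D.map Mon.s → f s = 0) :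
    N α f = ∑ i ∈ Finset.range 7, wF α D (f s0) f i := by
  rw [N_eq hP]
  apply Finset.sum_congr rfl
  intro i _
  apply Finset.sum_congr rfl
  intro j _
  rw [cw_eq hα hT f hf, nzF_mul _ _ (pow_ne_zero _ (gen_ne hα))]
theorem wF_scale (D : List Mon) (c0 : F8) (h0 : c0 ≠ 0) (f : ℕ → F8) (i : ℕ) :
    wF α D c0 f i = wF α D 1 (fun s => c0⁻¹ * f s) i := by
  apply Finset.sum_congr rfl
  intro j _
  rw [← nzF_mul c0⁻¹ _ (inv_ne_zero h0)]
  congr 1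
  unfold G
  rw [mul_add, inv_mul_cancel₀ h0, ← List.sum_map_mul_left]
  simp only [mul_assoc]

theorem chkT_1 : ChkT D_1 1 1 0 2 6 := by unfold ChkT; decide +kernel
theorem chkT_2 : ChkT D_2 7 1 0 0 2 := by unfold ChkT; decide +kernel
theorem chkT_3 : ChkT D_3 2 1 0 3 5 := by unfold ChkT; decide +kernel
theorem chkT_4 : ChkT D_4 10 1 0 1 4 := by unfold ChkT; decide +kernel
theorem chkP_1 : ChkP 1 0 2 6 := by unfold ChkP; decide +kernel
theorem chkP_2 : ChkP 1 0 0 2 := by unfold ChkP; decide +kernel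
theorem chkP_3 : ChkP 1 0 3 5 := by unfold ChkP; decide +kernel
theorem chkP_4 : ChkP 1 0 1 4 := by unfold ChkP; decide +kernel
theorem out_1 : ∀ s < 17, s ∉ 1 :: D_1.map Mon.s → False := by decide +kernel
theorem out_2 : ∀ s < 17, s ∉ 7 :: D_2.map Mon.s → s = 1 := by decide +kernel
theorem out_3 : ∀ s < 17, s ∉ 2 :: D_3.map Mon.s → s = 1 ∨ s = 7 := by decide +kernel
theorem out_4 : ∀ s < 17, s ∉ 10 :: D_4.map Mon.s → s = 1 ∨ s = 7 ∨ s = 2 := by decide +kernel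

theorem lower (hα : α^3 = α + 1) (f : ℕ → F8) (h1 : 1 ≤ N α f) : 23 ≤ N α f := by
  by_cases g1 : f 1 = 0
  swap
  · rw [N_wF hα chkT_1 chkP_1 f (fun s hs hn => (out_1 s hs hn).elim)]
    simp only [wF_scale D_1 (f 1) g1 f]
    exact step_1 hα _
  by_cases g2 : f 7 = 0
  swap
  · rw [N_wF hα chkT_2 chkP_2 f (fun s hs hn => by rw [out_2 s hs hn]; exact g1)]
    simp only [wF_scale D_2 (f 7) g2 f]
    exact step_2 hα _
  by_cases g3 : f 2 = 0
  swap
  · rw [N_wF hα chkT_3 chkP_3 f (fun s hs hn => by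
      rcases out_3 s hs hn with rfl | rfl <;> assumption)]
    simp only [wF_scale D_3 (f 2) g3 f]
    exact step_3 hα _
  have e := N_wF hα chkT_4 chkP_4 f (fun s hs hn => by
      rcases out_4 s hs hn with rfl | rfl | rfl <;> assumption)
  by_cases g4 : f 10 = 0
  swap
  · rw [e]
    simp only [wF_scale D_4 (f 10) g4 f]
    exact step_4 hα _
  rw [g4] at e
  rw [e] at h1 ⊢
  exact step_5 hα f h1

/-- coefficients of a codeword of weight 23 -/
def wd : ℕ := 2169799326242444
theorem wd_weight : ∑ i ∈ Finset.range 7, ∑ j ∈ Finset.range 7, nz (1 ^^^ ev D_1 wd i j) = 23 := by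
  decide +kernel
theorem upper (hα : α^3 = α + 1) : ∃ f : ℕ → F8, N α f = 23 := by
  refine ⟨fun s => dec α (dig wd s), ?_⟩
  rw [N_wF hα chkT_1 chkP_1 _ (fun s hs hn => (out_1 s hs hn).elim)]
  have h1 : dig wd 1 = 1 := by decide +kernel
  simp only [h1, dec_one]
  rw [← wd_weight]
  apply Finset.sum_congr rfl
  intro i _
  exact wF1 hα D_1 chkD_1.1 _ wd (fun s _ => rfl) i

theorem hw_eq (hα : α^3 = α + 1) (f : ℕ → F8) (c : F8ˣ × F8ˣ → F8)
    (hc : c = ∑ s : Fin 17, f s • evalVec (sx s)) : hammingWeight c = N α f := by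
  classical
  have : Fintype F8ˣ := Fintype.ofFinite F8ˣ
  let u : F8ˣ := Units.mk0 α (gen_ne hα)
  have surj : Function.Surjective (fun k : Fin 7 => u^(k : ℕ)) := by
    intro x
    obtain ⟨e, he, hx⟩ := eq_pow hα (x : F8) x.ne_zero
    exact ⟨⟨e, he⟩, Units.ext (by simp [u, hx])⟩
  have bij : Function.Bijective (fun k : Fin 7 => u^(k : ℕ)) := by
    apply surj.bijective_of_nat_card_le
    rw [Nat.card_units, card_F8]; simp
  have bij2 : Function.Bijective (fun k : Fin 7 × Fin 7 => (u^(k.1 : ℕ), u^(k.2 : ℕ))) :=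
    bij.prodMap bij
  have hcv : ∀ X Y : ℕ, c (u^X, u^Y) = cw α f X Y := by
    intro X Y
    rw [hc, Finset.sum_apply]
    unfold cw
    rw [← Fin.sum_univ_eq_sum_range (fun s => f s * α^((sx s).1 * X + (sx s).2 * Y)) 17]
    apply Finset.sum_congr rfl
    intro s _
    simp only [Pi.smul_apply, smul_eq_mul, evalVec, Units.val_pow_eq_pow_val, u, Units.val_mk0]
    rw [← pow_mul, ← pow_mul, ← pow_add]
    congr 2; ring
  unfold hammingWeight
  rw [Nat.card_eq_fintype_card, Fintype.card_subtype, Finset.card_filter]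
  have e1 : ∀ p : F8ˣ × F8ˣ, (if c p ≠ 0 then 1 else 0) = nzF (c p) := by
    intro p; unfold nzF
    by_cases h : c p = 0 <;> simp [h]
  simp only [e1]
  rw [← bij2.sum_comp (fun p => nzF (c p)), Fintype.sum_prod_type]
  simp only [hcv]
  unfold N
  rw [← Fin.sum_univ_eq_sum_range (fun X => ∑ Y ∈ Finset.range 7, nzF (cw α f X Y)) 7]
  apply Finset.sum_congr rfl
  intro X _
  rw [← Fin.sum_univ_eq_sum_range (fun Y => nzF (cw α f X Y)) 7]

theorem span_iff (c : F8ˣ × F8ˣ → F8) : c ∈ Submodule.span F8 (evalVec '' S) ↔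
    ∃ f : ℕ → F8, c = ∑ s : Fin 17, f s • evalVec (sx s) := by
  rw [S_eq, ← Set.range_comp, Submodule.mem_span_range_iff_exists_fun]
  constructor
  · rintro ⟨g, hg⟩
    refine ⟨fun s => if h : s < 17 then g ⟨s, h⟩ else 0, ?_⟩
    rw [← hg]
    apply Finset.sum_congr rfl
    intro s _
    simp
  · rintro ⟨f, hf⟩
    exact ⟨fun s => f s, hf.symm⟩
end gen

theorem main :
    (∀ c ∈ Submodule.span F8 (evalVec '' S), c ≠ 0 → 23 ≤ hammingWeight c) ∧
    (∃ c ∈ Submodule.span F8 (evalVec '' S), hammingWeight c = 23) := by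
  obtain ⟨α, hα⟩ := exists_gen
  constructor
  · intro c hc h0
    obtain ⟨f, hf⟩ := (span_iff c).mp hc
    have e := hw_eq hα f c hf
    rw [e]
    apply lower hα
    rw [← e]
    unfold hammingWeight
    have : ∃ p, c p ≠ 0 := by
      by_contra hcon
      push Not at hcon
      exact h0 (funext hcon)
    obtain ⟨p, hp⟩ := this
    have : Nonempty {p : F8ˣ × F8ˣ // c p ≠ 0} := ⟨⟨p, hp⟩⟩
    exact Nat.card_pos
  · obtain ⟨f, hf⟩ := upper hα
    exact ⟨_, (span_iff _).mpr ⟨f, rfl⟩, (hw_eq hα f _ rfl).trans hf⟩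


end Tor

end

/-- The generalised toric code `C_S` over `F₈` has minimum distance exactly 23:
every nonzero codeword has Hamming weight at least 23, and some codeword has
Hamming weight exactly 23. -/
theorem min_dist :
    (∀ c ∈ Submodule.span F8 (evalVec '' S), c ≠ 0 → 23 ≤ hammingWeight c) ∧
    (∃ c ∈ Submodule.span F8 (evalVec '' S), hammingWeight c = 23) := by
  exact Tor.main
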